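/- arXiv:2501.02382 — 2 statements merged into one kernel-verified Lean document; each statement's English description precedes it below -/
import Mathlib

section
/- Let w̃₂ ∈ W̃₁ and w̃₁ ∈ W̃⁺ be such that w̃₁ ↑ w̃_h⁻¹w̃₂, and let α be a simple root. Then the factorization w̃₂⁻¹(s_α w₀)w̃₁ is reduced, i.e. ℓ(w̃₂⁻¹ s_α w₀ w̃₁) = ℓ(w̃₂⁻¹) + ℓ(s_α w₀) + ℓ(w̃₁). -/
open scoped Classical Pointwise

namespace SerrePaper

variable (V : Type) [AddCommGroup V] [Module ℝ V]

/-- The combinatorial context of the paper: the character lattice `X` of a split maximal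
torus, sitting inside the real vector space `V = X ⊗ ℝ`, together with a reduced
crystallographic root system `R` with positive roots `Rpos`, simple roots `Δ`,
the coroot pairing `coroot α = ⟨·, α∨⟩`, the weight `η` pairing to `1` with every simple
coroot, and the longest element `w0` of the Weyl group. -/
structure Ctx where
  R : Finset V
  Rpos : Finset V
  Δ : Finset V
  coroot : V → V →ₗ[ℝ] ℝ
  eta : V
  w0 : V ≃ₗ[ℝ] V
  X : AddSubgroup V
  pos_subset : Rpos ⊆ R
  simple_subset : Δ ⊆ Rpos
  root_ne_zero : ∀ α ∈ R, α ≠ (0 : V)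
  neg_mem : ∀ α ∈ R, -α ∈ R
  pos_or_neg : ∀ α ∈ R, α ∈ Rpos ∨ -α ∈ Rpos
  pos_not_neg : ∀ α ∈ Rpos, -α ∉ Rpos
  coroot_self : ∀ α ∈ R, coroot α α = 2
  coroot_neg : ∀ α ∈ R, coroot (-α) = -coroot α
  crystallographic : ∀ α ∈ R, ∀ β ∈ R, ∃ n : ℤ, coroot α β = (n : ℝ)
  reduced : ∀ α ∈ R, ∀ c : ℝ, c • α ∈ R → c = 1 ∨ c = -1
  reflect_root : ∀ α ∈ R, ∀ β ∈ R, β - coroot α β • α ∈ R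
  reflect_coroot : ∀ α ∈ R, ∀ β ∈ R, ∀ x : V,
    coroot (β - coroot α β • α) x = coroot β x - coroot β α * coroot α x
  pos_sum_simple : ∀ α ∈ Rpos, ∃ c : V → ℕ, α = ∑ β ∈ Δ, (c β : ℝ) • β
  simple_indep : LinearIndependent ℝ (fun β : {x // x ∈ Δ} => (β : V))
  eta_pair : ∀ α ∈ Δ, coroot α eta = 1
  root_mem_X : ∀ α ∈ R, α ∈ X
  eta_mem_X : eta ∈ X
  coroot_int : ∀ α ∈ R, ∀ x ∈ X, ∃ n : ℤ, coroot α x = (n : ℝ)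
  w0_mem : w0 ∈ Subgroup.closure {g : V ≃ₗ[ℝ] V | ∃ α ∈ R, ∀ x, g x = x - coroot α x • α}
  w0_neg : ∀ α ∈ Rpos, -(w0 α) ∈ Rpos

namespace Ctx

variable {V}
variable (S : Ctx V)

/-- The (finite) Weyl group, generated by the reflections `s_α`, `α ∈ R`. -/
def Weyl : Subgroup (V ≃ₗ[ℝ] V) :=
  Subgroup.closure {g : V ≃ₗ[ℝ] V | ∃ α ∈ S.R, ∀ x, g x = x - S.coroot α x • α}

/-- The translation `t_ν` as an affine automorphism of `V`. -/
def trans (_S : Ctx V) (ν : V) : V ≃ᵃ[ℝ] V := AffineEquiv.constVAdd ℝ V ν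

/-- A linear automorphism viewed as an affine automorphism. -/
def ofW (_S : Ctx V) (w : V ≃ₗ[ℝ] V) : V ≃ᵃ[ℝ] V := w.toAffineEquiv

/-- The extended affine Weyl group `W̃ = X ⋊ W`, realized as the set of affine
transformations of the form `t_ν ∘ w` with `ν ∈ X` and `w ∈ W`. -/
def extAff : Set (V ≃ᵃ[ℝ] V) :=
  {g | ∃ ν ∈ S.X, ∃ w ∈ S.Weyl, g = S.trans ν * S.ofW w}

/-- The base alcove `A₀`. -/
def A0 : Set V := {x | ∀ α ∈ S.Rpos, 0 < S.coroot α x ∧ S.coroot α x < 1}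

/-- The affine hyperplane `⟨·,α∨⟩ = n` separates the base alcove `A₀` from its image
`g(A₀)`. -/
def Separates (α : V) (n : ℤ) (g : V ≃ᵃ[ℝ] V) : Prop :=
  ((∀ x ∈ S.A0, S.coroot α x < (n : ℝ)) ∧ (∀ x ∈ S.A0, (n : ℝ) < S.coroot α (g x))) ∨
  ((∀ x ∈ S.A0, (n : ℝ) < S.coroot α x) ∧ (∀ x ∈ S.A0, S.coroot α (g x) < (n : ℝ)))

/-- The length `ℓ(g)` of an element of the extended affine Weyl group: the number of
affine root hyperplanes separating `A₀` from `g(A₀)`. -/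
noncomputable def len (g : V ≃ᵃ[ℝ] V) : ℕ :=
  Set.ncard {q : V × ℤ | q.1 ∈ S.Rpos ∧ S.Separates q.1 q.2 g}

/-- The set of affine reflections `s_{α,n} : x ↦ x - (⟨x,α∨⟩ - n)α`. -/
def affRefl : Set (V ≃ᵃ[ℝ] V) :=
  {g | ∃ α ∈ S.R, ∃ n : ℤ, ∀ x, g x = x - (S.coroot α x - (n : ℝ)) • α}

/-- The Bruhat order on the extended affine Weyl group, generated by
`u < r·u` for affine reflections `r` with `ℓ(u) < ℓ(r·u)` (this fixes the
`Ω`-component, so it is the componentwise extension of the Bruhat order on `W_a`). -/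
def bruhatLE : (V ≃ᵃ[ℝ] V) → (V ≃ᵃ[ℝ] V) → Prop :=
  Relation.ReflTransGen fun u w => (∃ r ∈ S.affRefl, w = r * u) ∧ S.len u < S.len w

/-- Jantzen's `↑`-order, transported to the (extended) affine Weyl group via
`w̃ ↦ w̃(A₀)`: generated by `u ↑ s_{α,n}·u` whenever `u(A₀)` lies below the hyperplane
`⟨·,α∨⟩ = n`.  (Under the affine rescaling `λ ↦ (λ+η)/p` this is equivalent to the usual
`↑`-order on `p`-alcoves, transported via the `p`-dot action `w̃ ↦ w̃ · C₀`.) -/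
def upLE : (V ≃ᵃ[ℝ] V) → (V ≃ᵃ[ℝ] V) → Prop :=
  Relation.ReflTransGen fun u w =>
    ∃ α ∈ S.Rpos, ∃ n : ℤ,
      (∀ x : V, w x = u x - (S.coroot α (u x) - (n : ℝ)) • α) ∧
      ∀ x ∈ S.A0, S.coroot α (u x) < (n : ℝ)

/-- `W̃⁺`: the elements of `W̃` taking the base alcove to a dominant alcove. -/
def Wplus : Set (V ≃ᵃ[ℝ] V) :=
  {g | g ∈ S.extAff ∧ ∀ x ∈ S.A0, ∀ α ∈ S.Δ, 0 < S.coroot α (g x)}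

/-- `W̃₁`: the elements of `W̃` taking the base alcove to a restricted alcove. -/
def Wone : Set (V ≃ᵃ[ℝ] V) :=
  {g | g ∈ S.extAff ∧ ∀ x ∈ S.A0, ∀ α ∈ S.Δ,
    0 < S.coroot α (g x) ∧ S.coroot α (g x) < 1}

/-- `w̃_h = w₀ t_{-η}`. -/
noncomputable def wh : V ≃ᵃ[ℝ] V := S.ofW S.w0 * S.trans (-S.eta)

/-- The lowest `p`-alcove `C₀`. -/
def C0 (p : ℕ) : Set V :=
  {x | ∀ α ∈ S.Rpos, 0 < S.coroot α (x + S.eta) ∧ S.coroot α (x + S.eta) < (p : ℝ)}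

/-- The root lattice `ℤR`. -/
def rootLattice : AddSubgroup V := AddSubgroup.closure (S.R : Set V)

/-- `Ω`: the stabilizer of the base alcove in `W̃`. -/
def Omega : Set (V ≃ᵃ[ℝ] V) := {g | g ∈ S.extAff ∧ g '' S.A0 = S.A0}

/-- The `λ`-admissible set `Adm(λ) = ⋃_{w ∈ W} W̃_{≤ t_{w(λ)}}`. -/
def Adm (lam : V) : Set (V ≃ᵃ[ℝ] V) :=
  {g | ∃ w ∈ S.Weyl, S.bruhatLE g (S.trans (w lam))}

/-- `α∨` is a highest coroot, i.e. the highest root of an irreducible component of the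
dual root system `R∨`: equivalently, `α∨` is a dominant coroot and no simple coroot can
be added to `α∨` to yield a coroot. -/
def IsHighestCoroot (α : V) : Prop :=
  α ∈ S.R ∧ (∀ β ∈ S.Δ, 0 ≤ S.coroot α β) ∧
    ∀ β ∈ S.Δ, ∀ γ ∈ S.R, S.coroot γ ≠ S.coroot α + S.coroot β

/-- A linear automorphism preserving the roots and compatible with the coroot pairing. -/
def IsRootAut (w : V ≃ₗ[ℝ] V) : Prop :=
  ∀ β ∈ S.R, w β ∈ S.R ∧ ∀ x, S.coroot (w β) (w x) = S.coroot β x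

/-- `g` acts on the coroots through `w`, up to integral translations. -/
def ActsBy (w : V ≃ₗ[ℝ] V) (g : V ≃ᵃ[ℝ] V) : Prop :=
  ∀ β ∈ S.R, w β ∈ S.R ∧ ∃ n : ℤ, ∀ x, S.coroot (w β) (g x) = n + S.coroot β x

variable {S}

theorem reflection_reflection {α : V} (hα : α ∈ S.R) {s : V ≃ₗ[ℝ] V}
    (hs : ∀ x, s x = x - S.coroot α x • α) (x : V) : s (s x) = x := by
  have h : S.coroot α (s x) = -S.coroot α x := by
    rw [hs, map_sub, map_smul, S.coroot_self α hα, smul_eq_mul]; ring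
  rw [hs (s x), h, hs]
  module

theorem coroot_reflection {α β : V} (hα : α ∈ S.R) (hβ : β ∈ S.R) {s : V ≃ₗ[ℝ] V}
    (hs : ∀ x, s x = x - S.coroot α x • α) (x : V) :
    S.coroot (s β) x = S.coroot β (s x) := by
  rw [hs β, hs x, S.reflect_coroot α hα β hβ, map_sub, map_smul, smul_eq_mul]; ring

theorem isRootAut_reflection {α : V} (hα : α ∈ S.R) {s : V ≃ₗ[ℝ] V}
    (hs : ∀ x, s x = x - S.coroot α x • α) : S.IsRootAut s := by
  intro β hβ
  refine ⟨by rw [hs]; exact S.reflect_root α hα β hβ, fun x => ?_⟩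
  rw [coroot_reflection hα hβ hs, reflection_reflection hα hs]

theorem exists_preimage_root {w : V ≃ₗ[ℝ] V} (hw : ∀ β ∈ S.R, w β ∈ S.R) {β : V}
    (hβ : β ∈ S.R) : ∃ γ ∈ S.R, w γ = β := by
  have h : S.R.image w = S.R :=
    Finset.eq_of_subset_of_card_le (Finset.image_subset_iff.2 hw)
      (Finset.card_image_of_injective _ w.injective).ge
  rw [← h] at hβ
  exact Finset.mem_image.1 hβ

theorem isRootAut_of_mem_weyl {w : V ≃ₗ[ℝ] V} (hw : w ∈ S.Weyl) : S.IsRootAut w := by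
  induction hw using Subgroup.closure_induction with
  | mem s hs =>
    obtain ⟨α, hα, hs⟩ := hs
    exact isRootAut_reflection hα hs
  | one => exact fun β hβ => ⟨hβ, fun _ => rfl⟩
  | mul u v _ _ hu hv =>
    intro β hβ
    exact ⟨(hu _ (hv β hβ).1).1, fun x => ((hu _ (hv β hβ).1).2 (v x)).trans ((hv β hβ).2 x)⟩
  | inv u _ hu =>
    intro β hβ
    obtain ⟨γ, hγ, rfl⟩ := exists_preimage_root (fun β hβ => (hu β hβ).1) hβ
    have h : u⁻¹ (u γ) = γ := u.symm_apply_apply γ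
    rw [h]
    refine ⟨hγ, fun x => ?_⟩
    rw [← (hu γ hγ).2]
    congr 1
    exact u.apply_symm_apply x

theorem IsRootAut.actsBy {w : V ≃ₗ[ℝ] V} (hw : S.IsRootAut w) : S.ActsBy w (S.ofW w) :=
  fun β hβ => ⟨(hw β hβ).1, 0, fun x => by simpa [ofW] using (hw β hβ).2 x⟩

theorem ActsBy.mul {u v : V ≃ₗ[ℝ] V} {g h : V ≃ᵃ[ℝ] V} (hg : S.ActsBy u g)
    (hh : S.ActsBy v h) : S.ActsBy (u * v) (g * h) := by
  intro β hβ
  obtain ⟨hβ', m, hm⟩ := hh β hβ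
  obtain ⟨hβ'', n, hn⟩ := hg _ hβ'
  refine ⟨hβ'', n + m, fun x => ?_⟩
  have := hn (h x)
  rw [hm] at this
  push_cast
  rw [add_assoc]
  exact this

theorem ActsBy.inv {w : V ≃ₗ[ℝ] V} {g : V ≃ᵃ[ℝ] V} (hg : S.ActsBy w g) :
    S.ActsBy w⁻¹ g⁻¹ := by
  intro β hβ
  obtain ⟨γ, hγ, rfl⟩ := exists_preimage_root (fun β hβ => (hg β hβ).1) hβ
  have h : w⁻¹ (w γ) = γ := w.symm_apply_apply γ
  rw [h]
  obtain ⟨-, n, hn⟩ := hg γ hγ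
  refine ⟨hγ, -n, fun x => ?_⟩
  have hx : g (g⁻¹ x) = x := g.apply_symm_apply x
  have := hn (g⁻¹ x)
  rw [hx] at this
  push_cast
  linarith

theorem actsBy_one : S.ActsBy 1 1 := fun β hβ => ⟨hβ, 0, fun x => by simp⟩

theorem actsBy_of_mem_extAff {g : V ≃ᵃ[ℝ] V} (hg : g ∈ S.extAff) : ∃ w, S.ActsBy w g := by
  obtain ⟨ν, hν, w, hw, rfl⟩ := hg
  refine ⟨w, fun β hβ => ?_⟩
  have h := isRootAut_of_mem_weyl hw β hβ
  obtain ⟨n, hn⟩ := S.coroot_int _ h.1 ν hν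
  refine ⟨h.1, n, fun x => ?_⟩
  have : (S.trans ν * S.ofW w) x = ν + w x := rfl
  rw [this, map_add, hn, h.2]

theorem ActsBy.exists_strip {w : V ≃ₗ[ℝ] V} {g : V ≃ᵃ[ℝ] V} (hg : S.ActsBy w g) {β : V}
    (hβ : β ∈ S.R) :
    ∃ m : ℤ, ∀ x ∈ S.A0, (m : ℝ) < S.coroot β (g x) ∧ S.coroot β (g x) < m + 1 := by
  obtain ⟨γ, hγ, rfl⟩ := exists_preimage_root (fun β hβ => (hg β hβ).1) hβ
  obtain ⟨-, n, hn⟩ := hg γ hγ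
  rcases S.pos_or_neg γ hγ with h | h
  · refine ⟨n, fun x hx => ?_⟩
    have := hx γ h
    rw [hn]
    constructor <;> linarith
  · refine ⟨n - 1, fun x hx => ?_⟩
    have := hx _ h
    rw [S.coroot_neg γ hγ, LinearMap.neg_apply] at this
    rw [hn]
    push_cast
    constructor <;> linarith

theorem ActsBy.strip {w : V ≃ₗ[ℝ] V} {g : V ≃ᵃ[ℝ] V} (hg : S.ActsBy w g) {β x y : V}
    (hβ : β ∈ S.R) (hx : x ∈ S.A0) (hy : y ∈ S.A0) :
    (⌊S.coroot β (g x)⌋ : ℝ) < S.coroot β (g y) ∧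
      S.coroot β (g y) < ⌊S.coroot β (g x)⌋ + 1 := by
  obtain ⟨m, hm⟩ := hg.exists_strip hβ
  rw [Int.floor_eq_iff.2 ⟨(hm x hx).1.le, (hm x hx).2⟩]
  exact hm y hy

theorem ActsBy.separates_iff {w : V ≃ₗ[ℝ] V} {g : V ≃ᵃ[ℝ] V} (hg : S.ActsBy w g) {β x : V}
    (hβ : β ∈ S.Rpos) (hx : x ∈ S.A0) (n : ℤ) :
    S.Separates β n g ↔
      n ∈ Finset.Ioc (min 0 ⌊S.coroot β (g x)⌋) (max 0 ⌊S.coroot β (g x)⌋) := by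
  have hβR := S.pos_subset hβ
  set k := ⌊S.coroot β (g x)⌋ with hk
  have hs : ∀ y ∈ S.A0, (k : ℝ) < S.coroot β (g y) ∧ S.coroot β (g y) < k + 1 :=
    fun y hy => hg.strip hβR hx hy
  have key : n ∈ Finset.Ioc (min 0 k) (max 0 k) ↔ (1 ≤ n ∧ n ≤ k) ∨ (n ≤ 0 ∧ k + 1 ≤ n) := by
    rw [Finset.mem_Ioc]; omega
  rw [key]
  refine or_congr (and_congr ?_ ?_) (and_congr ?_ ?_)
  · constructor
    · intro h
      have := (hx β hβ).1.trans (h x hx)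
      exact_mod_cast this
    · intro h y hy
      have : (1 : ℝ) ≤ n := by exact_mod_cast h
      linarith [(hx β hβ).2, (hy β hβ).2]
  · constructor
    · intro h
      have : (n : ℝ) < k + 1 := (h x hx).trans (hs x hx).2
      exact Int.lt_add_one_iff.1 (by exact_mod_cast this)
    · intro h y hy
      have : (n : ℝ) ≤ k := by exact_mod_cast h
      linarith [(hs y hy).1]
  · constructor
    · intro h
      have : (n : ℝ) < 0 + 1 := by linarith [h x hx, (hx β hβ).2]
      exact Int.lt_add_one_iff.1 (by exact_mod_cast this)
    · intro h y hy
      have : (n : ℝ) ≤ 0 := by exact_mod_cast h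
      linarith [(hy β hβ).1]
  · constructor
    · intro h
      have : (k : ℝ) < n := (hs x hx).1.trans (h x hx)
      exact_mod_cast this
    · intro h y hy
      have : (k : ℝ) + 1 ≤ n := by exact_mod_cast h
      linarith [(hs y hy).2]

theorem ActsBy.len_eq {w : V ≃ₗ[ℝ] V} {g : V ≃ᵃ[ℝ] V} (hg : S.ActsBy w g) {x : V}
    (hx : x ∈ S.A0) : (S.len g : ℤ) = ∑ β ∈ S.Rpos, |⌊S.coroot β (g x)⌋| := by
  let I : V → Finset ℤ := fun β =>
    Finset.Ioc (min 0 ⌊S.coroot β (g x)⌋) (max 0 ⌊S.coroot β (g x)⌋)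
  have h : {q : V × ℤ | q.1 ∈ S.Rpos ∧ S.Separates q.1 q.2 g} =
      ((S.Rpos.sigma I).map (Equiv.sigmaEquivProd V ℤ).toEmbedding : Finset (V × ℤ)) := by
    ext ⟨β, n⟩
    simp only [Set.mem_ofPred_eq, Finset.coe_map, Set.mem_image, Finset.mem_coe,
      Finset.mem_sigma]
    constructor
    · rintro ⟨hβ, h⟩
      exact ⟨⟨β, n⟩, ⟨hβ, (hg.separates_iff hβ hx n).1 h⟩, rfl⟩
    · rintro ⟨⟨γ, m⟩, ⟨hγ, h⟩, he⟩
      obtain ⟨rfl, rfl⟩ := Prod.mk.inj he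
      exact ⟨hγ, (hg.separates_iff hγ hx m).2 h⟩
  rw [len, h, Set.ncard_coe_finset, Finset.card_map, Finset.card_sigma, Nat.cast_sum]
  refine Finset.sum_congr rfl fun β _ => ?_
  rw [Int.card_Ioc]
  grind

/-- Twice the number of hyperplanes separating the alcoves of `g` and `h`, computed from the
coordinates of the images of a point `x` of the base alcove. -/
noncomputable def alcoveDist (S : Ctx V) (x : V) (g h : V ≃ᵃ[ℝ] V) : ℤ :=
  ∑ β ∈ S.R, |⌊S.coroot β (g x)⌋ - ⌊S.coroot β (h x)⌋|

theorem ActsBy.floor_neg {w : V ≃ₗ[ℝ] V} {g : V ≃ᵃ[ℝ] V} (hg : S.ActsBy w g) {β x : V}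
    (hβ : β ∈ S.R) (hx : x ∈ S.A0) :
    ⌊S.coroot (-β) (g x)⌋ = -⌊S.coroot β (g x)⌋ - 1 := by
  have := hg.strip hβ hx hx
  rw [S.coroot_neg β hβ, LinearMap.neg_apply, Int.floor_eq_iff]
  push_cast
  constructor <;> linarith

theorem sum_roots_of_even {f : V → ℤ} (hf : ∀ β ∈ S.R, f (-β) = f β) :
    ∑ β ∈ S.R, f β = 2 * ∑ β ∈ S.Rpos, f β := by
  have hd : Disjoint S.Rpos (S.Rpos.image Neg.neg) := by
    rw [Finset.disjoint_left]
    intro β hβ hβ'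
    obtain ⟨γ, hγ, rfl⟩ := Finset.mem_image.1 hβ'
    exact S.pos_not_neg γ hγ hβ
  have hR : S.R = S.Rpos ∪ S.Rpos.image Neg.neg := by
    ext β
    rw [Finset.mem_union, Finset.mem_image]
    constructor
    · intro h
      exact (S.pos_or_neg β h).imp id fun h => ⟨-β, h, neg_neg β⟩
    · rintro (h | ⟨γ, hγ, rfl⟩)
      · exact S.pos_subset h
      · exact S.neg_mem γ (S.pos_subset hγ)
  rw [hR, Finset.sum_union hd, Finset.sum_image fun _ _ _ _ h => neg_injective h, two_mul]
  congr 1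
  exact Finset.sum_congr rfl fun β hβ => hf β (S.pos_subset hβ)

theorem ActsBy.alcoveDist_eq {u v : V ≃ₗ[ℝ] V} {g h : V ≃ᵃ[ℝ] V} (hg : S.ActsBy u g)
    (hh : S.ActsBy v h) {x : V} (hx : x ∈ S.A0) : S.alcoveDist x g h =
      2 * ∑ β ∈ S.Rpos, |⌊S.coroot β (g x)⌋ - ⌊S.coroot β (h x)⌋| := by
  refine sum_roots_of_even fun β hβ => ?_
  rw [hg.floor_neg hβ hx, hh.floor_neg hβ hx, abs_sub_comm]
  congr 1
  ring

theorem ActsBy.alcoveDist_mul_left {w : V ≃ₗ[ℝ] V} {f : V ≃ᵃ[ℝ] V} (hf : S.ActsBy w f)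
    (x : V) (g h : V ≃ᵃ[ℝ] V) : S.alcoveDist x (f * g) (f * h) = S.alcoveDist x g h := by
  symm
  refine Finset.sum_nbij w (fun β hβ => (hf β hβ).1) w.injective.injOn
    (fun β hβ => exists_preimage_root (fun β hβ => (hf β hβ).1) hβ) fun β hβ => ?_
  obtain ⟨-, n, hn⟩ := hf β hβ
  have e (k : V ≃ᵃ[ℝ] V) : ⌊S.coroot (w β) ((f * k) x)⌋ = n + ⌊S.coroot β (k x)⌋ := by
    rw [← Int.floor_intCast_add, ← hn]
    rfl
  rw [e, e, add_sub_add_left_eq_sub]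

theorem floor_coroot_eq_zero {β x : V} (hβ : β ∈ S.Rpos) (hx : x ∈ S.A0) :
    ⌊S.coroot β x⌋ = 0 := by
  rw [Int.floor_eq_zero_iff]
  exact ⟨(hx β hβ).1.le, (hx β hβ).2⟩

theorem ActsBy.alcoveDist_one {w : V ≃ₗ[ℝ] V} {g : V ≃ᵃ[ℝ] V} (hg : S.ActsBy w g) {x : V}
    (hx : x ∈ S.A0) : S.alcoveDist x 1 g = 2 * S.len g := by
  rw [actsBy_one.alcoveDist_eq hg hx, hg.len_eq hx]
  congr 1
  refine Finset.sum_congr rfl fun β hβ => ?_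
  have : ⌊S.coroot β ((1 : V ≃ᵃ[ℝ] V) x)⌋ = 0 := floor_coroot_eq_zero hβ hx
  rw [this, zero_sub, abs_neg]

theorem ActsBy.alcoveDist_eq_len {u v : V ≃ₗ[ℝ] V} {f g : V ≃ᵃ[ℝ] V} (hf : S.ActsBy u f)
    (hg : S.ActsBy v g) {x : V} (hx : x ∈ S.A0) :
    S.alcoveDist x f g = 2 * S.len (f⁻¹ * g) := by
  rw [← (hf.inv.mul hg).alcoveDist_one hx, ← hf.alcoveDist_mul_left x 1, mul_one,
    mul_inv_cancel_left]

/-- The canonical Weyl-invariant form `∑_δ ⟨x, δ∨⟩⟨y, δ∨⟩`. -/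
def form (S : Ctx V) (x : V) : V →ₗ[ℝ] ℝ := ∑ δ ∈ S.R, S.coroot δ x • S.coroot δ

theorem form_apply (x y : V) :
    S.form x y = ∑ δ ∈ S.R, S.coroot δ x * S.coroot δ y := by
  simp [form]

theorem coroot_mul_form {β : V} (hβ : β ∈ S.R) (x : V) :
    S.coroot β x * S.form β β = 2 * S.form x β := by
  let s : V ≃ₗ[ℝ] V := LinearEquiv.ofInvolutive
    (LinearMap.id - (S.coroot β).smulRight β) fun x => by
      simp only [LinearMap.sub_apply, LinearMap.id_apply, LinearMap.smulRight_apply, map_sub,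
        map_smul, S.coroot_self β hβ]
      module
  have hs : ∀ x, s x = x - S.coroot β x • β := fun x => rfl
  have hinv : S.form (s x) (s β) = S.form x β := by
    rw [form_apply, form_apply]
    symm
    refine Finset.sum_nbij s (fun δ hδ => (isRootAut_reflection hβ hs δ hδ).1)
      s.injective.injOn
      (fun δ hδ => exists_preimage_root (fun γ hγ => (isRootAut_reflection hβ hs γ hγ).1) hδ)
      fun δ hδ => ?_
    rw [(isRootAut_reflection hβ hs δ hδ).2, (isRootAut_reflection hβ hs δ hδ).2]
  have hsβ : s β = -β := by
    rw [hs, S.coroot_self β hβ]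
    module
  have hsx : S.form (s x) β = S.form x β - S.coroot β x * S.form β β := by
    simp only [form_apply, hs, map_sub, map_smul, smul_eq_mul, sub_mul, Finset.sum_sub_distrib,
      Finset.mul_sum, mul_assoc]
  rw [hsβ, map_neg, hsx] at hinv
  linarith

theorem form_self_pos {β : V} (hβ : β ∈ S.R) : 0 < S.form β β := by
  rw [form_apply]
  refine Finset.sum_pos' (fun δ _ => mul_self_nonneg _) ⟨β, hβ, ?_⟩
  rw [S.coroot_self β hβ]
  norm_num

theorem coroot_pos_of_dominant {x : V} (hx : ∀ α ∈ S.Δ, 0 < S.coroot α x) {β : V}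
    (hβ : β ∈ S.Rpos) : 0 < S.coroot β x := by
  have hR {γ : V} (hγ : γ ∈ S.Δ) : γ ∈ S.R := S.pos_subset (S.simple_subset hγ)
  have hpos {γ : V} (hγ : γ ∈ S.Δ) : 0 < S.form x γ := by
    have := mul_pos (hx γ hγ) (form_self_pos (hR hγ))
    rw [coroot_mul_form (hR hγ)] at this
    linarith
  obtain ⟨c, hc⟩ := S.pos_sum_simple β hβ
  have h : 0 < S.form x β := by
    rw [hc, map_sum]
    refine Finset.sum_pos' (fun γ hγ => ?_) ?_
    · rw [map_smul]
      exact mul_nonneg (Nat.cast_nonneg _) (hpos hγ).le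
    · by_contra! h
      refine S.root_ne_zero β (S.pos_subset hβ) ?_
      rw [hc]
      refine Finset.sum_eq_zero fun γ hγ => ?_
      have h0 := h γ hγ
      rw [map_smul, smul_eq_mul] at h0
      have : (c γ : ℝ) ≤ 0 := nonpos_of_mul_nonpos_left h0 (hpos hγ)
      rw [le_antisymm this (Nat.cast_nonneg _), zero_smul]
  have := coroot_mul_form (S.pos_subset hβ) x
  exact pos_of_mul_pos_left (by linarith) (form_self_pos (S.pos_subset hβ)).le

theorem smul_eta_mem_A0 {p : ℕ} (hηp : ∀ α ∈ S.R, S.coroot α S.eta < (p : ℝ)) :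
    (p : ℝ)⁻¹ • S.eta ∈ S.A0 := by
  intro β hβ
  have hη : 0 < S.coroot β S.eta :=
    coroot_pos_of_dominant (fun α hα => by rw [S.eta_pair α hα]; exact one_pos) hβ
  have hlt := hηp β (S.pos_subset hβ)
  have hp : (0 : ℝ) < p := hη.trans hlt
  rw [map_smul, smul_eq_mul]
  refine ⟨by positivity, ?_⟩
  rw [inv_mul_lt_iff₀ hp]
  linarith

theorem reflection_mem_Rpos {α β : V} (hα : α ∈ S.Δ) (hβ : β ∈ S.Rpos) (hne : β ≠ α)
    {s : V ≃ₗ[ℝ] V} (hs : ∀ x, s x = x - S.coroot α x • α) : s β ∈ S.Rpos := by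
  have hαR := S.pos_subset (S.simple_subset hα)
  have hβR := S.pos_subset hβ
  refine (S.pos_or_neg _ (isRootAut_reflection hαR hs β hβR).1).resolve_right fun hn => ?_
  obtain ⟨c, hc⟩ := S.pos_sum_simple β hβ
  obtain ⟨d, hd⟩ := S.pos_sum_simple _ hn
  have hsum : ∑ γ ∈ S.Δ, ((c γ : ℝ) + d γ - if γ = α then S.coroot α β else 0) • γ = 0 := by
    simp only [add_smul, sub_smul, Finset.sum_add_distrib, Finset.sum_sub_distrib, ite_smul,
      zero_smul, Finset.sum_ite_eq', if_pos hα]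
    rw [← hc, ← hd, hs]
    module
  have hcoef := linearIndepOn_finset_iff.1 (show LinearIndepOn ℝ id (S.Δ : Set V) from
    S.simple_indep) _ hsum
  have hzero : ∀ γ ∈ S.Δ, γ ≠ α → (c γ : ℝ) = 0 := by
    intro γ hγ hγα
    have := hcoef γ hγ
    rw [if_neg hγα, sub_zero] at this
    have h1 : (0 : ℝ) ≤ c γ := Nat.cast_nonneg _
    have h2 : (0 : ℝ) ≤ d γ := Nat.cast_nonneg _
    linarith
  have hβα : β = (c α : ℝ) • α := by
    conv_lhs => rw [hc]
    exact Finset.sum_eq_single_of_mem α hα fun γ hγ h => by rw [hzero γ hγ h, zero_smul]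
  rcases S.reduced α hαR (c α) (hβα ▸ hβR) with h | h
  · exact hne (by rw [hβα, h, one_smul])
  · have : (0 : ℝ) ≤ c α := Nat.cast_nonneg _
    linarith

theorem exists_coroot_w0 {β : V} (hβ : β ∈ S.Rpos) :
    ∃ γ ∈ S.Rpos, ∀ x, S.coroot β (S.w0 x) = -S.coroot γ x := by
  have hw := isRootAut_of_mem_weyl (S := S) S.w0_mem
  obtain ⟨γ, hγ, rfl⟩ := exists_preimage_root (fun β hβ => (hw β hβ).1) (S.pos_subset hβ)
  refine ⟨-γ, (S.pos_or_neg γ hγ).resolve_left fun h => ?_, fun x => ?_⟩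
  · exact S.pos_not_neg _ hβ (S.w0_neg γ h)
  · rw [(hw γ hγ).2, S.coroot_neg γ hγ, LinearMap.neg_apply, neg_neg]

end Ctx


/-- Lemma `reduced1`: if `w̃₂ ∈ W̃₁`, `w̃₁ ∈ W̃⁺` with `w̃₁ ↑ w̃_h⁻¹w̃₂`, and
`α` is a simple root, then the factorization `w̃₂⁻¹ (s_α w₀) w̃₁` is reduced. -/
theorem statement0 {V : Type} [AddCommGroup V] [Module ℝ V] [FiniteDimensional ℝ V]
    (S : Ctx V) (p : ℕ) (hp : p.Prime) (hηp : ∀ α ∈ S.R, S.coroot α S.eta < (p : ℝ))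
    (w₂ w₁ : V ≃ᵃ[ℝ] V) (hw₂ : w₂ ∈ S.Wone) (hw₁ : w₁ ∈ S.Wplus)
    (hup : S.upLE w₁ (S.wh⁻¹ * w₂))
    (α : V) (hα : α ∈ S.Δ)
    (sα : V ≃ₗ[ℝ] V) (hsα : ∀ x, sα x = x - S.coroot α x • α) :
    S.len (w₂⁻¹ * (S.ofW sα * S.ofW S.w0) * w₁)
      = S.len w₂⁻¹ + S.len (S.ofW sα * S.ofW S.w0) + S.len w₁ := by
  have hαpos := S.simple_subset hα
  have hαR := S.pos_subset hαpos
  have hx := Ctx.smul_eta_mem_A0 hηp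
  set x := (p : ℝ)⁻¹ • S.eta
  obtain ⟨u₁, hu₁⟩ := Ctx.actsBy_of_mem_extAff hw₁.1
  obtain ⟨u₂, hu₂⟩ := Ctx.actsBy_of_mem_extAff hw₂.1
  have hσ := (Ctx.isRootAut_reflection hαR hsα).actsBy.mul
    (Ctx.isRootAut_of_mem_weyl (S := S) S.w0_mem).actsBy
  have hσapp : ∀ y, (S.ofW sα * S.ofW S.w0) y = sα (S.w0 y) := fun y => rfl
  set σ := S.ofW sα * S.ofW S.w0
  have key : S.alcoveDist x w₂ (σ * w₁) =
      S.alcoveDist x w₂ 1 + S.alcoveDist x 1 σ + S.alcoveDist x σ (σ * w₁) := by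
    rw [hu₂.alcoveDist_eq (hσ.mul hu₁) hx, hu₂.alcoveDist_eq Ctx.actsBy_one hx,
      Ctx.actsBy_one.alcoveDist_eq hσ hx, hσ.alcoveDist_eq (hσ.mul hu₁) hx, ← mul_add, ← mul_add,
      ← Finset.sum_add_distrib, ← Finset.sum_add_distrib]
    congr 1
    refine Finset.sum_congr rfl fun β hβ => ?_
    have hone : ⌊S.coroot β ((1 : V ≃ᵃ[ℝ] V) x)⌋ = 0 := Ctx.floor_coroot_eq_zero hβ hx
    have hmul : (σ * w₁) x = σ (w₁ x) := rfl
    rw [hone, hmul, hσapp, hσapp]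
    by_cases hβα : β = α
    · subst hβα
      obtain ⟨γ, hγ, hγw⟩ := Ctx.exists_coroot_w0 hβ
      have hs : ∀ y, S.coroot β (sα (S.w0 y)) = S.coroot γ y := fun y => by
        rw [hsα, map_sub, map_smul, S.coroot_self β hαR, smul_eq_mul, hγw]; ring
      have h₂ : ⌊S.coroot β (w₂ x)⌋ = 0 :=
        Int.floor_eq_zero_iff.2 ⟨(hw₂.2 x hx β hα).1.le, (hw₂.2 x hx β hα).2⟩
      rw [hs, hs, h₂, Ctx.floor_coroot_eq_zero hγ hx]
      simp
    · obtain ⟨γ, hγ, hγw⟩ := Ctx.exists_coroot_w0 (Ctx.reflection_mem_Rpos hα hβ hβα hsα)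
      have hs : ∀ y, S.coroot β (sα (S.w0 y)) = -S.coroot γ y := fun y => by
        rw [← Ctx.coroot_reflection hαR (S.pos_subset hβ) hsα, hγw]
      have h₂ : 0 ≤ ⌊S.coroot β (w₂ x)⌋ := Int.floor_nonneg.2
        (Ctx.coroot_pos_of_dominant (fun δ hδ => (hw₂.2 x hx δ hδ).1) hβ).le
      have h₁ : ⌊-S.coroot γ (w₁ x)⌋ < 0 := by
        rw [Int.floor_lt, Int.cast_zero, neg_lt_zero]
        exact Ctx.coroot_pos_of_dominant (hw₁.2 x hx) hγ
      have h₀ : ⌊-S.coroot γ x⌋ = -1 := by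
        rw [Int.floor_eq_iff]
        have := hx γ hγ
        push_cast
        constructor <;> linarith
      rw [hs, hs, h₀]
      grind
  rw [hu₂.alcoveDist_eq_len (hσ.mul hu₁) hx, hu₂.alcoveDist_eq_len Ctx.actsBy_one hx,
    Ctx.actsBy_one.alcoveDist_eq_len hσ hx, hσ.alcoveDist_eq_len (hσ.mul hu₁) hx, inv_one,
    one_mul, mul_one, inv_mul_cancel_left, ← mul_assoc] at key
  omega

end SerrePaper
end

section
/- Let α be a simple root such that ⟨ω_α,β∨⟩ ≤ 1 for all roots β. Let w̃₂ ∈ W̃₁ and w̃₁ ∈ W̃⁺ be such that w̃₁ ↑ w̃_h⁻¹w̃₂. Then (s_α w̃₂)^⋄ w̃₂⁻¹ s_α w₀ w̃₁ ≤ w₀ w̃_h⁻¹ (s_α w̃₂)^⋄ in the Bruhat order on W̃. -/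
open scoped Classical Pointwise

namespace SerrePaper

variable (V : Type) [AddCommGroup V] [Module ℝ V]

namespace Ctx

variable {V}
variable (S : Ctx V)

lemma simple_mem {β : V} (hβ : β ∈ S.Δ) : β ∈ S.R := S.pos_subset (S.simple_subset hβ)

lemma coroot_reflect {γ β : V} (hγ : γ ∈ S.R) (hβ : β ∈ S.R) (x : V) :
    S.coroot (β - S.coroot γ β • γ) x = S.coroot β (x - S.coroot γ x • γ) := by
  rw [S.reflect_coroot γ hγ β hβ, map_sub, map_smul, smul_eq_mul, mul_comm]

/-- The reflection in a root, as a linear automorphism. -/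
lemma exists_reflection {γ : V} (hγ : γ ∈ S.R) :
    ∃ s : V ≃ₗ[ℝ] V, s ∈ S.Weyl ∧ ∀ x, s x = x - S.coroot γ x • γ := by
  have key : ∀ x, Module.reflection (S.coroot_self γ hγ) x = x - S.coroot γ x • γ := fun x =>
    Module.reflection_apply x (S.coroot_self γ hγ)
  exact ⟨_, Subgroup.subset_closure ⟨γ, hγ, key⟩, key⟩

lemma reflection_inv {γ : V} (hγ : γ ∈ S.R) {g : V ≃ₗ[ℝ] V}
    (hg : ∀ x, g x = x - S.coroot γ x • γ) : g⁻¹ = g := by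
  rw [inv_eq_iff_mul_eq_one]
  ext x
  change g (g x) = x
  rw [hg (g x), hg x, map_sub, map_smul, S.coroot_self γ hγ]
  simp only [smul_eq_mul]
  module

/-- Weyl group elements permute the roots compatibly with coroots. -/
lemma weyl_root {w : V ≃ₗ[ℝ] V} (hw : w ∈ S.Weyl) :
    ∀ β ∈ S.R, w β ∈ S.R ∧ ∀ x, S.coroot (w β) (w x) = S.coroot β x := by
  refine (Subgroup.closure_induction (p := fun w _ =>
    (∀ β ∈ S.R, w β ∈ S.R ∧ ∀ x, S.coroot (w β) (w x) = S.coroot β x) ∧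
    (∀ β ∈ S.R, w⁻¹ β ∈ S.R ∧ ∀ x, S.coroot (w⁻¹ β) (w⁻¹ x) = S.coroot β x))
    ?_ ?_ ?_ ?_ hw).1
  · rintro g ⟨γ, hγ, hg⟩
    rw [S.reflection_inv hγ hg, and_self]
    intro β hβ
    refine ⟨by rw [hg]; exact S.reflect_root γ hγ β hβ, fun x => ?_⟩
    rw [hg β, S.coroot_reflect hγ hβ, hg x, map_sub (S.coroot γ), map_smul,
      S.coroot_self γ hγ]
    congr 1
    simp only [smul_eq_mul]
    module
  · simp
  · rintro x y - - ⟨hx, hx'⟩ ⟨hy, hy'⟩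
    constructor
    · intro β hβ
      exact ⟨(hx _ (hy β hβ).1).1, fun z => ((hx _ (hy β hβ).1).2 _).trans ((hy β hβ).2 z)⟩
    · intro β hβ
      rw [mul_inv_rev]
      exact ⟨(hy' _ (hx' β hβ).1).1, fun z => ((hy' _ (hx' β hβ).1).2 _).trans ((hx' β hβ).2 z)⟩
  · rintro x - ⟨hx, hx'⟩
    exact ⟨hx', by rwa [inv_inv]⟩

lemma weyl_pullback {w : V ≃ₗ[ℝ] V} (hw : w ∈ S.Weyl) {β : V} (hβ : β ∈ S.R) :
    ∃ β' ∈ S.R, ∀ x, S.coroot β (w x) = S.coroot β' x := by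
  have h := S.weyl_root (inv_mem hw) β hβ
  exact ⟨w⁻¹ β, h.1, fun x => by rw [← h.2 (w x)]; congr 1; exact w.symm_apply_apply x⟩

lemma weyl_X {w : V ≃ₗ[ℝ] V} (hw : w ∈ S.Weyl) : ∀ x ∈ S.X, w x ∈ S.X := by
  refine (Subgroup.closure_induction (p := fun w _ =>
    (∀ x ∈ S.X, w x ∈ S.X) ∧ (∀ x ∈ S.X, w⁻¹ x ∈ S.X)) ?_ ?_ ?_ ?_ hw).1
  · rintro g ⟨γ, hγ, hg⟩
    rw [S.reflection_inv hγ hg, and_self]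
    intro x hx
    obtain ⟨n, hn⟩ := S.coroot_int γ hγ x hx
    rw [hg, hn, Int.cast_smul_eq_zsmul]
    exact sub_mem hx (zsmul_mem (S.root_mem_X γ hγ) n)
  · simp
  · rintro x y - - ⟨hx, hx'⟩ ⟨hy, hy'⟩
    refine ⟨fun z hz => hx _ (hy z hz), fun z hz => ?_⟩
    rw [mul_inv_rev]
    exact hy' _ (hx' z hz)
  · rintro x - ⟨hx, hx'⟩
    exact ⟨hx', by rwa [inv_inv]⟩

/-- A coroot of a positive root is a nonnegative, nonzero combination of simple coroots. -/
lemma pos_coroot_combination {γ : V} (hγ : γ ∈ S.Rpos) :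
    ∃ c : V → ℝ, (∀ β, 0 ≤ c β) ∧ (∃ β ∈ S.Δ, 0 < c β) ∧
      ∀ x, S.coroot γ x = ∑ β ∈ S.Δ, c β * S.coroot β x := by
  set B : V → V → ℝ := fun x y => ∑ δ ∈ S.R, S.coroot δ x * S.coroot δ y with hB
  have hpos : ∀ β ∈ S.R, 0 < B β β := by
    intro β hβ
    refine Finset.sum_pos' (fun δ _ => mul_self_nonneg _) ⟨β, hβ, ?_⟩
    rw [S.coroot_self β hβ]; norm_num
  have hform : ∀ β ∈ S.R, ∀ x, 2 * B β x = B β β * S.coroot β x := by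
    intro β hβ x
    have hinv : ∀ y z, B (y - S.coroot β y • β) (z - S.coroot β z • β) = B y z := by
      intro y z
      refine Finset.sum_bij' (fun δ _ => δ - S.coroot β δ • β) (fun δ _ => δ - S.coroot β δ • β)
        (fun δ hδ => S.reflect_root β hβ δ hδ) (fun δ hδ => S.reflect_root β hβ δ hδ) ?_ ?_ ?_
      · intro δ _
        rw [map_sub, map_smul, S.coroot_self β hβ]; simp only [smul_eq_mul]; module
      · intro δ _
        rw [map_sub, map_smul, S.coroot_self β hβ]; simp only [smul_eq_mul]; module
      · intro δ hδ
        rw [S.coroot_reflect hβ hδ, S.coroot_reflect hβ hδ]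
    have h1 := hinv β x
    rw [S.coroot_self β hβ] at h1
    have h2 : B (β - (2 : ℝ) • β) (x - S.coroot β x • β) = - B β x + S.coroot β x * B β β := by
      simp only [hB, map_sub, map_smul, smul_eq_mul, Finset.mul_sum, ← Finset.sum_neg_distrib,
        ← Finset.sum_add_distrib]
      exact Finset.sum_congr rfl fun δ _ => by ring
    linarith
  have hγR := S.pos_subset hγ
  obtain ⟨c, hc⟩ := S.pos_sum_simple γ hγ
  have hsum : ∀ x, B γ x = ∑ β ∈ S.Δ, (c β : ℝ) * B β x := by
    intro x
    simp only [hB, Finset.mul_sum]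
    rw [Finset.sum_comm]
    refine Finset.sum_congr rfl fun δ _ => ?_
    conv_lhs => rw [hc]
    simp only [map_sum, map_smul, smul_eq_mul, Finset.sum_mul, mul_assoc]
  have hBnn : ∀ x, 0 ≤ B x x := fun x => Finset.sum_nonneg fun δ _ => mul_self_nonneg _
  refine ⟨fun β => c β * B β β / B γ γ, fun β => ?_, ?_, fun x => ?_⟩
  · have := hBnn β; have := hBnn γ; positivity
  · by_contra hcon
    push Not at hcon
    apply S.root_ne_zero γ hγR
    rw [hc]
    refine Finset.sum_eq_zero fun β hβ => ?_
    have h1 := hpos β (S.simple_mem hβ)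
    have h2 := hpos γ hγR
    have h3 := hcon β hβ
    by_cases h0 : c β = 0
    · simp [h0]
    · have : (0 : ℝ) < c β := by positivity
      have : 0 < c β * B β β / B γ γ := by positivity
      linarith
  · have h2 := hpos γ hγR
    have : B γ γ * S.coroot γ x = ∑ β ∈ S.Δ, (c β : ℝ) * (B β β * S.coroot β x) := by
      rw [← hform γ hγR, hsum, Finset.mul_sum]
      refine Finset.sum_congr rfl fun β hβ => ?_
      rw [← hform β (S.simple_mem hβ)]; ring
    calc S.coroot γ x = (B γ γ * S.coroot γ x) / B γ γ := by field_simp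
      _ = _ := by
        rw [this, Finset.sum_div]
        exact Finset.sum_congr rfl fun β _ => by ring

lemma pos_coroot_nonneg {γ : V} (hγ : γ ∈ S.Rpos) {x : V}
    (hx : ∀ β ∈ S.Δ, 0 ≤ S.coroot β x) : 0 ≤ S.coroot γ x := by
  obtain ⟨c, hc, -, h⟩ := S.pos_coroot_combination hγ
  rw [h]
  exact Finset.sum_nonneg fun β hβ => mul_nonneg (hc β) (hx β hβ)

lemma pos_coroot_pos {γ : V} (hγ : γ ∈ S.Rpos) {x : V}
    (hx : ∀ β ∈ S.Δ, 0 < S.coroot β x) : 0 < S.coroot γ x := by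
  obtain ⟨c, hc, ⟨β, hβ, hcβ⟩, h⟩ := S.pos_coroot_combination hγ
  rw [h]
  exact Finset.sum_pos' (fun β hβ => mul_nonneg (hc β) (hx β hβ).le)
    ⟨β, hβ, mul_pos hcβ (hx β hβ)⟩

lemma one_le_coroot_eta {γ : V} (hγ : γ ∈ S.Rpos) : 1 ≤ S.coroot γ S.eta := by
  have h := S.pos_coroot_pos hγ (x := S.eta) fun β hβ => by rw [S.eta_pair β hβ]; norm_num
  obtain ⟨n, hn⟩ := S.coroot_int γ (S.pos_subset hγ) _ S.eta_mem_X
  rw [hn] at h ⊢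
  exact_mod_cast h

/-- Positive roots with proportional coroots coincide. -/
lemma eq_of_coroot_proportional {γ γ' : V} (hγ : γ ∈ S.R) (hγ' : γ' ∈ S.R) {c : ℝ} (hc : 0 < c)
    (h : S.coroot γ' = c • S.coroot γ) : γ = γ' := by
  have hself := S.coroot_self γ hγ
  have hself' := S.coroot_self γ' hγ'
  set v := γ - c • γ' with hv
  have hγv : S.coroot γ v = 0 := by
    have : c * S.coroot γ γ' = 2 := by rw [← hself', h]; rfl
    rw [hv, map_sub, map_smul, smul_eq_mul, this, hself, sub_self]
  have horbit : ∀ k : ℕ, γ + ((2 * k : ℕ) : ℝ) • v ∈ S.R := by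
    intro k
    induction k with
    | zero => simpa using hγ
    | succ k ih =>
      have h1 := S.reflect_root γ hγ _ (S.reflect_root γ' hγ' _ ih)
      convert h1 using 1
      have h2 : S.coroot γ (γ + ((2 * k : ℕ) : ℝ) • v) = 2 := by
        rw [map_add, map_smul, hγv, hself]; simp
      have h4 : c * S.coroot γ γ' = 2 := by rw [← hself', h]; rfl
      rw [h, LinearMap.smul_apply, smul_eq_mul, h2, map_sub, map_smul, h2, smul_eq_mul,
        show c * 2 * S.coroot γ γ' = 4 by linarith]
      push_cast
      rw [hv]
      module
  have hv0 : v = 0 := by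
    by_contra hne
    have hinj : Function.Injective fun k : ℕ => γ + ((2 * k : ℕ) : ℝ) • v := by
      intro a b hab
      have h1 := smul_left_injective ℝ hne (add_left_cancel hab)
      have h2 : 2 * a = 2 * b := by exact_mod_cast h1
      omega
    exact (Set.infinite_range_of_injective hinj)
      (S.R.finite_toSet.subset (by rintro _ ⟨k, rfl⟩; exact horbit k))
  have hγc : γ = c • γ' := sub_eq_zero.1 hv0
  rcases S.reduced γ' hγ' c (hγc ▸ hγ) with h1 | h1
  · rw [hγc, h1, one_smul]
  · linarith

lemma exists_simple_coord {β : V} (hβ : β ∈ S.Δ) :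
    ∃ f : V →ₗ[ℝ] ℝ, ∀ δ ∈ S.Δ, f δ = if δ = β then 1 else 0 := by
  obtain ⟨f, hf⟩ := LinearMap.exists_extend
    ((Module.Basis.span S.simple_indep).coord ⟨β, hβ⟩)
  refine ⟨f, fun δ hδ => ?_⟩
  have h1 : f δ = (Module.Basis.span S.simple_indep).coord ⟨β, hβ⟩
      (Module.Basis.span S.simple_indep ⟨δ, hδ⟩) := by
    rw [← hf, LinearMap.comp_apply, Submodule.subtype_apply, Module.Basis.span_apply]
  rw [h1, Module.Basis.coord_apply, Module.Basis.repr_self, Finsupp.single_apply]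
  simp

lemma pos_coord_nonneg {β : V} {f : V →ₗ[ℝ] ℝ}
    (hf : ∀ δ ∈ S.Δ, f δ = if δ = β then 1 else 0) {γ : V} (hγ : γ ∈ S.Rpos) : 0 ≤ f γ := by
  obtain ⟨c, hc⟩ := S.pos_sum_simple γ hγ
  rw [hc, map_sum]
  refine Finset.sum_nonneg fun δ hδ => ?_
  rw [map_smul, hf δ hδ, smul_eq_mul]
  split_ifs <;> simp

lemma coroot_simple_nonpos {α β : V} (hα : α ∈ S.Δ) (hβ : β ∈ S.Δ) (hne : β ≠ α) :
    S.coroot β α ≤ 0 := by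
  obtain ⟨f, hf⟩ := S.exists_simple_coord hα
  obtain ⟨g, hg⟩ := S.exists_simple_coord hβ
  have hmem := S.reflect_root β (S.simple_mem hβ) α (S.simple_mem hα)
  rcases S.pos_or_neg _ hmem with h | h
  · have := S.pos_coord_nonneg hg h
    rw [map_sub, map_smul, hg α hα, hg β hβ, if_neg hne.symm, if_pos rfl] at this
    simpa using this
  · have := S.pos_coord_nonneg hf h
    rw [map_neg, map_sub, map_smul, hf α hα, hf β hβ, if_neg hne, if_pos rfl] at this
    norm_num at this

/-- The longest element exchanges positive and negative coroots. -/
lemma coroot_w0 {γ : V} (hγ : γ ∈ S.Rpos) :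
    ∃ γ' ∈ S.Rpos, -(S.w0 γ') = γ ∧ ∀ x, S.coroot γ (S.w0 x) = -S.coroot γ' x := by
  have hsurj : Set.SurjOn (fun γ => -(S.w0 γ)) S.Rpos S.Rpos :=
    Finset.surjOn_of_injOn_of_card_le _ (fun γ hγ => S.w0_neg γ hγ)
      (fun a _ b _ h => S.w0.injective (neg_injective h)) le_rfl
  obtain ⟨γ', hγ', h⟩ := hsurj hγ
  refine ⟨γ', hγ', h, fun x => ?_⟩
  have h1 := S.weyl_root S.w0_mem γ' (S.pos_subset hγ')
  rw [← h, S.coroot_neg _ h1.1, LinearMap.neg_apply, h1.2]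

/-- The affine reflection in the hyperplane `⟨·,γ∨⟩ = n`, as a map. -/
def refl (γ : V) (n : ℤ) (x : V) : V := x - (S.coroot γ x - (n : ℝ)) • γ

lemma refl_refl {γ : V} (hγ : γ ∈ S.R) (n : ℤ) (x : V) :
    S.refl γ n (S.refl γ n x) = x := by
  simp only [refl, map_sub, map_smul, S.coroot_self γ hγ, smul_eq_mul]
  module

lemma coroot_refl_self {γ : V} (hγ : γ ∈ S.R) (n : ℤ) (x : V) :
    S.coroot γ (S.refl γ n x) - n = -(S.coroot γ x - n) := by
  simp only [refl, map_sub, map_smul, S.coroot_self γ hγ, smul_eq_mul]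
  ring

lemma refl_neg {γ : V} (hγ : γ ∈ S.R) (n : ℤ) (x : V) :
    S.refl (-γ) (-n) x = S.refl γ n x := by
  simp only [refl, S.coroot_neg γ hγ, LinearMap.neg_apply]
  push_cast
  module

lemma trans_apply (ν x : V) : S.trans ν x = ν + x := rfl

lemma ofW_apply (w : V ≃ₗ[ℝ] V) (x : V) : S.ofW w x = w x := rfl

lemma mul_apply' (g h : V ≃ᵃ[ℝ] V) (x : V) : (g * h) x = g (h x) := rfl

lemma trans_mul_mem {ν : V} (hν : ν ∈ S.X) {g : V ≃ᵃ[ℝ] V} (hg : g ∈ S.extAff) :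
    S.trans ν * g ∈ S.extAff := by
  obtain ⟨μ, hμ, w, hw, rfl⟩ := hg
  refine ⟨ν + μ, add_mem hν hμ, w, hw, ?_⟩
  ext x
  simp only [mul_apply', trans_apply, add_assoc]

lemma ofW_mul_mem {w : V ≃ₗ[ℝ] V} (hw : w ∈ S.Weyl) {g : V ≃ᵃ[ℝ] V} (hg : g ∈ S.extAff) :
    S.ofW w * g ∈ S.extAff := by
  obtain ⟨μ, hμ, w', hw', rfl⟩ := hg
  refine ⟨w μ, S.weyl_X hw μ hμ, w * w', mul_mem hw hw', ?_⟩
  ext x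
  simp only [mul_apply', trans_apply, ofW_apply, map_add]
  rfl

lemma one_mem_extAff : (1 : V ≃ᵃ[ℝ] V) ∈ S.extAff :=
  ⟨0, zero_mem _, 1, one_mem _, by ext x; simp [mul_apply', trans_apply, ofW_apply]⟩

lemma exists_affRefl {γ : V} (hγ : γ ∈ S.R) (n : ℤ) :
    ∃ r ∈ S.affRefl, (∀ x, r x = S.refl γ n x) ∧ ∀ g ∈ S.extAff, r * g ∈ S.extAff := by
  obtain ⟨s, hs, hsx⟩ := S.exists_reflection hγ
  have key : ∀ x, (S.trans ((n : ℝ) • γ) * S.ofW s) x = S.refl γ n x := by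
    intro x
    rw [mul_apply', trans_apply, ofW_apply, hsx, refl]
    module
  refine ⟨_, ⟨γ, hγ, n, key⟩, key, fun g hg => ?_⟩
  rw [mul_assoc]
  refine S.trans_mul_mem ?_ (S.ofW_mul_mem hs hg)
  rw [Int.cast_smul_eq_zsmul]
  exact zsmul_mem (S.root_mem_X γ hγ) n

/-- Every affine coroot takes values in an open unit interval on an alcove. -/
lemma alcove_interval {g : V ≃ᵃ[ℝ] V} (hg : g ∈ S.extAff) {β : V} (hβ : β ∈ S.R) :
    ∃ k : ℤ, ∀ x ∈ S.A0, (k : ℝ) < S.coroot β (g x) ∧ S.coroot β (g x) < k + 1 := by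
  obtain ⟨ν, hν, w, hw, rfl⟩ := hg
  obtain ⟨β', hβ', h⟩ := S.weyl_pullback hw hβ
  obtain ⟨n, hn⟩ := S.coroot_int β hβ ν hν
  have key : ∀ x, S.coroot β ((S.trans ν * S.ofW w) x) = n + S.coroot β' x := by
    intro x
    rw [mul_apply', trans_apply, ofW_apply, map_add, hn, h]
  rcases S.pos_or_neg β' hβ' with hp | hp
  · refine ⟨n, fun x hx => ?_⟩
    have := hx β' hp
    rw [key]
    constructor <;> linarith
  · refine ⟨n - 1, fun x hx => ?_⟩
    have := hx _ hp
    rw [S.coroot_neg β' hβ', LinearMap.neg_apply] at this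
    rw [key]
    push_cast
    constructor <;> linarith

lemma coroot_ne_int {g : V ≃ᵃ[ℝ] V} (hg : g ∈ S.extAff) {a : V} (ha : a ∈ S.A0) {β : V}
    (hβ : β ∈ S.R) (n : ℤ) : S.coroot β (g a) ≠ n := by
  obtain ⟨k, hk⟩ := S.alcove_interval hg hβ
  obtain ⟨h1, h2⟩ := hk a ha
  intro h
  rw [h] at h1 h2
  have h1' : k < n := by exact_mod_cast h1
  have h2' : n < k + 1 := by exact_mod_cast h2
  omega

/-- The image of an affine root `(β, m)` under the affine reflection in `(γ, n)`. -/
noncomputable def reflPair (γ : V) (n : ℤ) (q : V × ℤ) : V × ℤ :=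
  (q.1 - S.coroot γ q.1 • γ, q.2 - n * ⌊S.coroot q.1 γ⌋)

lemma floor_coroot {β γ : V} (hβ : β ∈ S.R) (hγ : γ ∈ S.R) :
    ((⌊S.coroot β γ⌋ : ℤ) : ℝ) = S.coroot β γ := by
  obtain ⟨k, hk⟩ := S.crystallographic β hβ γ hγ
  rw [hk, Int.floor_intCast]

lemma reflPair_mem {γ : V} (hγ : γ ∈ S.R) (n : ℤ) {q : V × ℤ} (hq : q.1 ∈ S.R) :
    (S.reflPair γ n q).1 ∈ S.R := S.reflect_root γ hγ _ hq

lemma reflPair_eval {γ : V} (hγ : γ ∈ S.R) (n : ℤ) {q : V × ℤ} (hq : q.1 ∈ S.R) (x : V) :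
    S.coroot (S.reflPair γ n q).1 x - (S.reflPair γ n q).2
      = S.coroot q.1 (S.refl γ n x) - q.2 := by
  simp only [reflPair, S.coroot_reflect hγ hq]
  push_cast
  rw [S.floor_coroot hq hγ]
  simp only [refl, map_sub, map_smul, smul_eq_mul]
  ring

lemma reflPair_reflPair {γ : V} (hγ : γ ∈ S.R) (n : ℤ) {q : V × ℤ} (hq : q.1 ∈ S.R) :
    S.reflPair γ n (S.reflPair γ n q) = q := by
  refine Prod.ext ?_ ?_
  · simp only [reflPair, map_sub, map_smul, S.coroot_self γ hγ, smul_eq_mul]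
    module
  · simp only [reflPair]
    have h1 : S.coroot (q.1 - S.coroot γ q.1 • γ) γ = ((-⌊S.coroot q.1 γ⌋ : ℤ) : ℝ) := by
      rw [S.coroot_reflect hγ hq, S.coroot_self γ hγ]
      push_cast
      rw [S.floor_coroot hq hγ]
      simp only [map_sub, map_smul, smul_eq_mul]
      ring
    rw [h1, Int.floor_intCast]
    ring

lemma reflPair_self {γ : V} (hγ : γ ∈ S.R) (n : ℤ) : S.reflPair γ n (γ, n) = (-γ, -n) := by
  simp only [reflPair, S.coroot_self γ hγ]
  refine Prod.ext (by simp only; module) ?_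
  have : ⌊(2 : ℝ)⌋ = 2 := by norm_num
  simp only [this]
  ring

/-- Affine roots whose hyperplanes separate the points `a` and `b`. -/
def sep (a b : V) : Set (V × ℤ) :=
  {q | q.1 ∈ S.R ∧ (S.coroot q.1 a - q.2) * (S.coroot q.1 b - q.2) < 0}

lemma neg_mem_sep {a b : V} {q : V × ℤ} (hq : q ∈ S.sep a b) : -q ∈ S.sep a b := by
  refine ⟨S.neg_mem _ hq.1, ?_⟩
  have := hq.2
  simp only [Prod.fst_neg, Prod.snd_neg, S.coroot_neg _ hq.1, LinearMap.neg_apply]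
  push_cast
  linarith

lemma sep_finite (a b : V) : (S.sep a b).Finite := by
  obtain ⟨M, hM⟩ : ∃ M : ℤ, ∀ β ∈ S.R, |S.coroot β a| + |S.coroot β b| ≤ M := by
    obtain ⟨M, hM⟩ := (S.R.image fun β => |S.coroot β a| + |S.coroot β b|).exists_le
    exact ⟨⌈M⌉, fun β hβ => (hM _ (Finset.mem_image_of_mem _ hβ)).trans (Int.le_ceil M)⟩
  refine (S.R.finite_toSet.prod (Set.finite_Icc (-M) M)).subset ?_
  rintro ⟨β, m⟩ ⟨hβ, h⟩
  have h1 := hM β hβ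
  simp only at h hβ
  refine ⟨hβ, ?_⟩
  have e1 := abs_le.1 (le_refl |S.coroot β a|)
  have e2 := abs_le.1 (le_refl |S.coroot β b|)
  have p1 := abs_nonneg (S.coroot β a)
  have p2 := abs_nonneg (S.coroot β b)
  have : -(M : ℝ) ≤ m ∧ (m : ℝ) ≤ M := by
    rcases mul_neg_iff.1 h with ⟨h2, h3⟩ | ⟨h2, h3⟩ <;> constructor <;> linarith
  exact ⟨by exact_mod_cast this.1, by exact_mod_cast this.2⟩

lemma two_mul_len {g : V ≃ᵃ[ℝ] V} (hg : g ∈ S.extAff) {a : V} (ha : a ∈ S.A0) :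
    2 * S.len g = (S.sep a (g a)).ncard := by
  set N : Set (V × ℤ) := {q | q.1 ∈ S.Rpos ∧ S.Separates q.1 q.2 g} with hN
  have hiff : ∀ q : V × ℤ, q.1 ∈ S.Rpos →
      (S.Separates q.1 q.2 g ↔ (S.coroot q.1 a - q.2) * (S.coroot q.1 (g a) - q.2) < 0) := by
    rintro ⟨β, m⟩ hβ
    simp only at hβ ⊢
    constructor
    · rintro (⟨h1, h2⟩ | ⟨h1, h2⟩)
      · exact mul_neg_of_neg_of_pos (by linarith [h1 a ha]) (by linarith [h2 a ha])
      · exact mul_neg_of_pos_of_neg (by linarith [h1 a ha]) (by linarith [h2 a ha])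
    · have side : ∀ g' ∈ S.extAff, (S.coroot β (g' a) < m → ∀ x ∈ S.A0, S.coroot β (g' x) < m) ∧
          ((m : ℝ) < S.coroot β (g' a) → ∀ x ∈ S.A0, (m : ℝ) < S.coroot β (g' x)) := by
        intro g' hg'
        obtain ⟨k, hk⟩ := S.alcove_interval hg' (S.pos_subset hβ)
        refine ⟨fun h x hx => ?_, fun h x hx => ?_⟩
        · have h1 : k < m := by exact_mod_cast (hk a ha).1.trans h
          have h2 : ((k + 1 : ℤ) : ℝ) ≤ m := by exact_mod_cast h1
          push_cast at h2
          linarith [(hk x hx).2]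
        · have h1 : m < k + 1 := by exact_mod_cast h.trans (hk a ha).2
          have h2 : ((m : ℤ) : ℝ) ≤ k := by exact_mod_cast Int.lt_add_one_iff.1 h1
          linarith [(hk x hx).1]
      intro h
      rcases mul_neg_iff.1 h with ⟨h1, h2⟩ | ⟨h1, h2⟩
      · exact Or.inr ⟨(side 1 S.one_mem_extAff).2 (by simpa using h1),
          (side g hg).1 (by linarith)⟩
      · exact Or.inl ⟨(side 1 S.one_mem_extAff).1 (by simpa using h1),
          (side g hg).2 (by linarith)⟩
  have hNsub : N ⊆ S.sep a (g a) := fun q hq =>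
    ⟨S.pos_subset hq.1, (hiff q hq.1).1 hq.2⟩
  have hunion : S.sep a (g a) = N ∪ Neg.neg '' N := by
    refine Set.Subset.antisymm (fun q hq => ?_) (Set.union_subset hNsub ?_)
    · rcases S.pos_or_neg _ hq.1 with hp | hp
      · exact Or.inl ⟨hp, (hiff q hp).2 hq.2⟩
      · exact Or.inr ⟨-q, ⟨hp, (hiff (-q) hp).2 (S.neg_mem_sep hq).2⟩, neg_neg q⟩
    · rintro _ ⟨q, hq, rfl⟩
      exact S.neg_mem_sep (hNsub hq)
  have hfin : N.Finite := (S.sep_finite a (g a)).subset hNsub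
  have hdisj : Disjoint N (Neg.neg '' N) := by
    rw [Set.disjoint_left]
    rintro q hq ⟨q', hq', rfl⟩
    exact S.pos_not_neg _ hq'.1 hq.1
  rw [hunion, Set.ncard_union_eq hdisj hfin (hfin.image _),
    Set.ncard_image_of_injective _ neg_injective, two_mul]
  rfl

lemma coroot_refl (β γ : V) (n : ℤ) (x : V) :
    S.coroot β (S.refl γ n x) = S.coroot β x - (S.coroot γ x - n) * S.coroot β γ := by
  simp only [refl, map_sub, map_smul, smul_eq_mul]

lemma mul_neg_of_reflected {A B h k c : ℝ} (hAB : A * B < 0) (hhk : 0 < h * k)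
    (hB : 0 ≤ A * (B - k * c)) : (A - h * c) * B < 0 := by
  have hc : 0 ≤ (h * c) * (k * c) := by
    have := mul_nonneg hhk.le (mul_self_nonneg c)
    linarith
  rcases mul_neg_iff.1 hAB with ⟨h1, h2⟩ | ⟨h1, h2⟩
  · have h3 : 0 ≤ B - k * c := nonneg_of_mul_nonneg_right hB h1
    refine mul_neg_of_pos_of_neg ?_ h2
    have : h * c ≤ 0 := by
      by_contra hcon
      push Not at hcon
      nlinarith
    linarith
  · have h3 : B - k * c ≤ 0 := by
      by_contra hcon
      push Not at hcon
      nlinarith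
    refine mul_neg_of_neg_of_pos ?_ h2
    have : 0 ≤ h * c := by
      by_contra hcon
      push Not at hcon
      nlinarith
    linarith

lemma len_lt {u w : V ≃ᵃ[ℝ] V} (hu : u ∈ S.extAff) (hw : w ∈ S.extAff) {a : V} (ha : a ∈ S.A0)
    {γ : V} (hγ : γ ∈ S.R) {n : ℤ} (huw : ∀ x, w x = S.refl γ n (u x))
    (hpos : 0 < (S.coroot γ a - n) * (S.coroot γ (u a) - n)) : S.len u < S.len w := by
  have hself := S.coroot_refl_self hγ n (u a)
  have hmem : (γ, n) ∈ S.sep a (w a) := by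
    refine ⟨hγ, ?_⟩
    simp only
    rw [huw, hself]
    linarith
  have hnot : (γ, n) ∉ S.sep a (u a) := fun h => by
    have := h.2
    simp only at this
    linarith
  have hle : (S.sep a (u a)).ncard ≤ (S.sep a (w a) \ {(γ, n)}).ncard := by
    refine Set.ncard_le_ncard_of_injOn
      (fun q => if q ∈ S.sep a (w a) then q else S.reflPair γ n q) ?_ ?_
      ((S.sep_finite _ _).subset Set.sdiff_subset)
    · intro q hq
      split_ifs with hqw
      · exact ⟨hqw, fun h => hnot (h ▸ hq)⟩
      · have hqn : ¬ (S.coroot q.1 a - q.2) * (S.coroot q.1 (w a) - q.2) < 0 :=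
          fun h => hqw ⟨hq.1, h⟩
        have hval := mul_neg_of_reflected hq.2 (c := S.coroot q.1 γ) hpos (by
          rw [huw, coroot_refl] at hqn
          linarith)
        refine ⟨⟨S.reflPair_mem hγ n hq.1, ?_⟩, fun h => hnot ?_⟩
        · rw [S.reflPair_eval hγ n hq.1, S.reflPair_eval hγ n hq.1, huw, S.refl_refl hγ,
            coroot_refl]
          linarith
        · have h' : S.reflPair γ n q = (γ, n) := h
          have h1 := S.reflPair_reflPair hγ n hq.1
          rw [h', S.reflPair_self hγ] at h1
          have h2 := S.neg_mem_sep hq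
          rw [← h1] at h2
          simpa using h2
    · have hback : ∀ q ∈ S.sep a (u a), q ∉ S.sep a (w a) →
          S.reflPair γ n q ∉ S.sep a (u a) := by
        intro q hq hqw h
        have hqn : ¬ (S.coroot q.1 a - q.2) * (S.coroot q.1 (w a) - q.2) < 0 :=
          fun h => hqw ⟨hq.1, h⟩
        have hval := mul_neg_of_reflected hq.2 (c := S.coroot q.1 γ) hpos (by
          rw [huw, coroot_refl] at hqn
          linarith)
        have h2 := h.2
        rw [S.reflPair_eval hγ n hq.1, S.reflPair_eval hγ n hq.1, ← huw, coroot_refl] at h2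
        have h3 := hq.2
        rcases mul_neg_iff.1 h2 with ⟨e1, e2⟩ | ⟨e1, e2⟩ <;>
        rcases mul_neg_iff.1 h3 with ⟨e3, e4⟩ | ⟨e3, e4⟩
        · exact hqn (mul_neg_of_pos_of_neg e3 e2)
        · linarith [mul_pos e1 e4]
        · linarith [mul_pos_of_neg_of_neg e1 e4]
        · exact hqn (mul_neg_of_neg_of_pos e3 e2)
      intro q hq q' hq' heq
      simp only at heq
      split_ifs at heq with h1 h2 h2
      · exact heq
      · exact (hback q' hq' h2 (heq ▸ hq)).elim
      · exact (hback q hq h1 (heq ▸ hq')).elim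
      · rw [← S.reflPair_reflPair hγ n hq.1, heq, S.reflPair_reflPair hγ n hq'.1]
  have hlt := Set.ncard_sdiff_singleton_lt_of_mem hmem (S.sep_finite _ _)
  have := S.two_mul_len hu ha
  have := S.two_mul_len hw ha
  omega

/-- One step of the Bruhat order with base point `b`: the reflecting hyperplane does not
separate `b` from the alcove of `u`, represented by the point `u a`. -/
def step (a b : V) (u w : V ≃ᵃ[ℝ] V) : Prop :=
  u ∈ S.extAff ∧ ∃ γ ∈ S.R, ∃ n : ℤ, (∀ x, w x = S.refl γ n (u x)) ∧
    0 < (S.coroot γ b - n) * (S.coroot γ (u a) - n)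

lemma step_bruhatLE {a : V} (ha : a ∈ S.A0) {u w : V ≃ᵃ[ℝ] V} (h : S.step a a u w) :
    S.bruhatLE u w := by
  obtain ⟨hu, γ, hγ, n, hw, hpos⟩ := h
  obtain ⟨r, hr, hrx, hrmem⟩ := S.exists_affRefl hγ n
  have hwr : w = r * u := by
    ext x
    rw [hw, mul_apply', hrx]
  exact .single ⟨⟨r, hr, hwr⟩, S.len_lt hu (hwr ▸ hrmem u hu) ha hγ hw hpos⟩

lemma refl_conj {γ : V} (hγ : γ ∈ S.R) (n : ℤ) {q : V × ℤ} (hq : q.1 ∈ S.R) (y : V) :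
    S.refl (S.reflPair γ n q).1 (S.reflPair γ n q).2 (S.refl γ n y)
      = S.refl γ n (S.refl q.1 q.2 y) := by
  have h := S.reflPair_eval hγ n hq (S.refl γ n y)
  rw [S.refl_refl hγ] at h
  rw [refl, h]
  simp only [reflPair, refl, map_sub, map_smul, smul_eq_mul]
  module

lemma same_sign_reflected {A A' h h' c : ℝ} (hA : 0 < A * A') (hh : h * h' < 0)
    (hr : 0 < (A - h * c) * (A' - h' * c)) : 0 < A' * (A' - h' * c) := by
  have hc : (h * c) * (h' * c) ≤ 0 := by
    have := mul_nonneg (neg_pos.2 hh).le (mul_self_nonneg c)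
    linarith
  by_contra hcon
  push Not at hcon
  rcases mul_pos_iff.1 hA with ⟨h1, h2⟩ | ⟨h1, h2⟩ <;>
  rcases mul_pos_iff.1 hr with ⟨h3, h4⟩ | ⟨h3, h4⟩ <;> nlinarith

lemma base_change_adjacent {a b b' γ : V} {n : ℤ} (ha : a ∈ S.A0) (hγ : γ ∈ S.R)
    (hsep : (S.coroot γ b - n) * (S.coroot γ b' - n) < 0)
    (huniq : ∀ q ∈ S.sep b b', q = (γ, n) ∨ q = -(γ, n))
    (hgen : ∀ β ∈ S.R, ∀ m : ℤ, S.coroot β b ≠ m)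
    (hgen' : ∀ β ∈ S.R, ∀ m : ℤ, S.coroot β b' ≠ m)
    {u v : V ≃ᵃ[ℝ] V} (hu : 0 < (S.coroot γ b' - n) * (S.coroot γ (u a) - n))
    (hv : 0 < (S.coroot γ b' - n) * (S.coroot γ (v a) - n))
    (hle : Relation.ReflTransGen (S.step a b) u v) :
    Relation.ReflTransGen (S.step a b') u v := by
  obtain ⟨σ, -, hσ, hσmem⟩ := S.exists_affRefl hγ n
  have hσσ : ∀ g : V ≃ᵃ[ℝ] V, σ * (σ * g) = g := by
    intro g
    ext x
    rw [mul_apply', mul_apply', hσ, hσ, S.refl_refl hγ]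
  have hsame : ∀ q : V × ℤ, q.1 ∈ S.R → q ≠ (γ, n) → q ≠ -(γ, n) →
      0 < (S.coroot q.1 b - q.2) * (S.coroot q.1 b' - q.2) := by
    intro q hq h1 h2
    rcases lt_trichotomy ((S.coroot q.1 b - q.2) * (S.coroot q.1 b' - q.2)) 0 with h | h | h
    · rcases huniq q ⟨hq, h⟩ with h | h <;> contradiction
    · rcases mul_eq_zero.1 h with h | h
      · exact (hgen _ hq _ (sub_eq_zero.1 h)).elim
      · exact (hgen' _ hq _ (sub_eq_zero.1 h)).elim
    · exact h
  have hsame' : ∀ q : V × ℤ, q.1 ∈ S.R → q ≠ (γ, n) → q ≠ -(γ, n) →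
      0 < (S.coroot q.1 b' - q.2) * (S.coroot q.1 (S.refl γ n b') - q.2) := by
    intro q hq h1 h2
    have hpm : S.reflPair γ n (-(γ, n)) = (γ, n) := by
      have := S.reflPair_reflPair hγ n (q := (γ, n)) hγ
      rwa [S.reflPair_self hγ] at this
    have h3 := hsame _ (S.reflPair_mem hγ n hq)
      (fun h => h2 (by
        rw [← S.reflPair_reflPair hγ n hq, h, S.reflPair_self hγ]; rfl))
      (fun h => h1 (by rw [← S.reflPair_reflPair hγ n hq, h, hpm]))
    rw [S.reflPair_eval hγ n hq, S.reflPair_eval hγ n hq, coroot_refl, coroot_refl] at h3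
    rw [coroot_refl]
    have := same_sign_reflected (c := S.coroot q.1 γ) (hsame q hq h1 h2) hsep (by linarith)
    linarith
  have hup : ∀ g ∈ S.extAff, ¬ 0 < (S.coroot γ b' - n) * (S.coroot γ (g a) - n) →
      0 < (S.coroot γ b' - n) * (S.coroot γ ((σ * g) a) - n) ∧ S.step a b' (σ * g) g := by
    intro g hg h
    have hne : (S.coroot γ b' - n) * (S.coroot γ (g a) - n) ≠ 0 :=
      mul_ne_zero (sub_ne_zero.2 (hgen' γ hγ n)) (sub_ne_zero.2 (S.coroot_ne_int hg ha hγ n))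
    have hlt := lt_of_le_of_ne (not_lt.1 h) hne
    have hval : 0 < (S.coroot γ b' - n) * (S.coroot γ ((σ * g) a) - n) := by
      rw [mul_apply', hσ, S.coroot_refl_self hγ]
      linarith
    refine ⟨hval, hσmem g hg, γ, hγ, n, fun x => ?_, hval⟩
    rw [mul_apply', hσ, S.refl_refl hγ]
  have hdown : ∀ g ∈ S.extAff, 0 < (S.coroot γ b' - n) * (S.coroot γ (g a) - n) →
      S.step a b' g (σ * g) := fun g hg h =>
    ⟨hg, γ, hγ, n, fun x => by rw [mul_apply', hσ], h⟩
  set proj : (V ≃ᵃ[ℝ] V) → (V ≃ᵃ[ℝ] V) := fun g =>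
    if 0 < (S.coroot γ b' - n) * (S.coroot γ (g a) - n) then g else σ * g with hproj
  have hstep : ∀ g h, S.step a b g h → Relation.ReflTransGen (S.step a b') (proj g) (proj h) := by
    rintro g h ⟨hg, β, hβ, m, hx, hpos⟩
    by_cases hcase : (β, m) = (γ, n) ∨ (β, m) = -(γ, n)
    · have hh : h = σ * g := by
        ext x
        rw [hx, mul_apply', hσ]
        rcases hcase with hc | hc
        · rw [Prod.mk.injEq] at hc
          rw [hc.1, hc.2]
        · rw [Prod.neg_mk, Prod.mk.injEq] at hc
          rw [hc.1, hc.2, S.refl_neg hγ]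
      have heq : proj g = proj h := by
        simp only [hproj]
        have hval : S.coroot γ (h a) - n = -(S.coroot γ (g a) - n) := by
          rw [hh, mul_apply', hσ, S.coroot_refl_self hγ]
        by_cases hside : 0 < (S.coroot γ b' - n) * (S.coroot γ (g a) - n)
        · rw [if_pos hside, if_neg (by rw [hval]; linarith), hh, hσσ]
        · have := (hup g hg hside).1
          rw [← hh] at this
          rw [if_neg hside, if_pos this, hh]
      rw [heq]
    · push Not at hcase
      have e1 := hsame (β, m) hβ hcase.1 hcase.2
      have e2 := hsame' (β, m) hβ hcase.1 hcase.2
      simp only at e1 e2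
      have hh : h ∈ S.extAff := by
        obtain ⟨r, -, hr, hrmem⟩ := S.exists_affRefl hβ m
        have : h = r * g := by
          ext x
          rw [hx, mul_apply', hr]
        exact this ▸ hrmem g hg
      have e3 : 0 < (S.coroot β b' - m) * (S.coroot β (g a) - m) := by
        have := mul_pos e1 hpos
        nlinarith [sq_nonneg (S.coroot β b - m)]
      have st : S.step a b' g h := ⟨hg, β, hβ, m, hx, e3⟩
      have stσ : S.step a b' (σ * g) (σ * h) := by
        refine ⟨hσmem g hg, _, S.reflPair_mem hγ n (q := (β, m)) hβ, (S.reflPair γ n (β, m)).2,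
          fun x => ?_, ?_⟩
        · rw [mul_apply', mul_apply', hσ, hσ, S.refl_conj hγ n (q := (β, m)) hβ, hx]
        · rw [S.reflPair_eval hγ n (q := (β, m)) hβ, mul_apply', hσ,
            S.reflPair_eval hγ n (q := (β, m)) hβ, S.refl_refl hγ]
          have := mul_pos e2 e3
          simp only
          nlinarith [sq_nonneg (S.coroot β b' - m)]
      simp only [hproj]
      split_ifs with s1 s2 s2
      · exact .single st
      · exact .tail (.single (hdown g hg s1)) stσ
      · exact .tail (.single (hup g hg s1).2) st
      · exact .single stσ
  have := Relation.ReflTransGen.lift' proj hstep _ _ hle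
  simpa only [hproj, Function.onFun, if_pos hu, if_pos hv] using this

lemma sep_ray {a : V} {t' t : ℝ} (ht : t' ≤ t) {q : V × ℤ}
    (hq : q ∈ S.sep (a + t • S.eta) (a + t' • S.eta)) :
    ∃ q' : V × ℤ, (q' = q ∨ q' = -q) ∧ q'.1 ∈ S.Rpos ∧
      S.coroot q'.1 (a + t' • S.eta) < q'.2 ∧ q'.2 < S.coroot q'.1 (a + t • S.eta) := by
  have key : ∀ q' ∈ S.sep (a + t • S.eta) (a + t' • S.eta), q'.1 ∈ S.Rpos →
      S.coroot q'.1 (a + t' • S.eta) < q'.2 ∧ q'.2 < S.coroot q'.1 (a + t • S.eta) := by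
    intro q' hq' hpos
    have h := hq'.2
    have hη := S.one_le_coroot_eta hpos
    simp only [map_add, map_smul, smul_eq_mul] at h ⊢
    have : t' * S.coroot q'.1 S.eta ≤ t * S.coroot q'.1 S.eta :=
      mul_le_mul_of_nonneg_right ht (by linarith)
    rcases mul_neg_iff.1 h with ⟨h1, h2⟩ | ⟨h1, h2⟩ <;> constructor <;> linarith
  rcases S.pos_or_neg _ hq.1 with hp | hp
  · exact ⟨q, Or.inl rfl, hp, key q hq hp⟩
  · exact ⟨-q, Or.inr rfl, hp, key (-q) (S.neg_mem_sep hq) hp⟩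

lemma base_change_ray {a : V} (ha : a ∈ S.A0)
    (hcol : ∀ γ ∈ S.Rpos, ∀ γ' ∈ S.Rpos, γ ≠ γ' → ∀ n n' : ℤ, ∀ t : ℝ,
      S.coroot γ (a + t • S.eta) = n → S.coroot γ' (a + t • S.eta) ≠ n')
    {u v : V ≃ᵃ[ℝ] V} (hu : ∀ γ ∈ S.Rpos, S.coroot γ (u a) < 1)
    (hv : ∀ γ ∈ S.Rpos, S.coroot γ (v a) < 1) (F : Finset (V × ℤ)) :
    ∀ t : ℝ, 0 ≤ t →
      (∀ q, q ∈ F ↔ q.1 ∈ S.Rpos ∧ S.coroot q.1 a < q.2 ∧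
        q.2 < S.coroot q.1 (a + t • S.eta)) →
      (∀ β ∈ S.R, ∀ m : ℤ, S.coroot β (a + t • S.eta) ≠ m) →
      Relation.ReflTransGen (S.step a (a + t • S.eta)) u v →
      Relation.ReflTransGen (S.step a a) u v := by
  have hgen0 : ∀ β ∈ S.R, ∀ m : ℤ, S.coroot β a ≠ m := fun β hβ m =>
    S.coroot_ne_int S.one_mem_extAff ha hβ m
  induction hk : F.card generalizing F with
  | zero =>
    intro t ht hF hgen hle
    rw [Finset.card_eq_zero] at hk
    refine Relation.ReflTransGen.mono ?_ _ _ hle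
    rintro g h ⟨hg, γ, hγ, n, hx, hpos⟩
    refine ⟨hg, γ, hγ, n, hx, ?_⟩
    have hns : ¬ (S.coroot γ (a + t • S.eta) - n) * (S.coroot γ a - n) < 0 := by
      intro h
      obtain ⟨q, -, hq⟩ := S.sep_ray (a := a) (q := (γ, n)) ht
        ⟨hγ, by simpa only [zero_smul, add_zero] using h⟩
      rw [zero_smul, add_zero] at hq
      have := (hF q).2 hq
      simp [hk] at this
    have hne : (S.coroot γ (a + t • S.eta) - n) * (S.coroot γ a - n) ≠ 0 :=
      mul_ne_zero (sub_ne_zero.2 (hgen γ hγ n)) (sub_ne_zero.2 (hgen0 γ hγ n))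
    have hp := lt_of_le_of_ne (not_lt.1 hns) hne.symm
    have := mul_pos hp hpos
    nlinarith [sq_nonneg (S.coroot γ (a + t • S.eta) - n)]
  | succ k ih =>
    intro t ht hF hgen hle
    have hη : ∀ {γ}, γ ∈ S.Rpos → 0 < S.coroot γ S.eta := fun h =>
      lt_of_lt_of_le one_pos (S.one_le_coroot_eta h)
    set T : V × ℤ → ℝ := fun q => (q.2 - S.coroot q.1 a) / S.coroot q.1 S.eta with hT
    have hTlt : ∀ {q : V × ℤ}, q.1 ∈ S.Rpos → ∀ s : ℝ,
        (q.2 < S.coroot q.1 (a + s • S.eta) ↔ T q < s) := by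
      intro q hq s
      rw [hT, div_lt_iff₀ (hη hq), map_add, map_smul, smul_eq_mul, sub_lt_iff_lt_add']
    have hTeq : ∀ {q : V × ℤ}, q.1 ∈ S.Rpos → ∀ s : ℝ,
        (S.coroot q.1 (a + s • S.eta) = q.2 ↔ s = T q) := by
      intro q hq s
      rw [hT, eq_div_iff (hη hq).ne', map_add, map_smul, smul_eq_mul, eq_sub_iff_add_eq']
    have hne : F.Nonempty := by rw [← Finset.card_pos]; omega
    obtain ⟨q, hqF, hqmax⟩ := F.exists_max_image T hne
    obtain ⟨hqpos, hqa, hqt⟩ := (hF q).1 hqF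
    have hlt : ∀ q' ∈ F, q' ≠ q → T q' < T q := by
      intro q' hq' hneq
      refine lt_of_le_of_ne (hqmax q' hq') fun heq => ?_
      have h1 := (hTeq hqpos (T q)).2 rfl
      have h2 := (hTeq ((hF q').1 hq').1 (T q)).2 heq.symm
      by_cases hroot : q.1 = q'.1
      · rw [hroot, h2] at h1
        exact hneq (Prod.ext hroot.symm (by exact_mod_cast h1))
      · exact hcol _ hqpos _ ((hF q').1 hq').1 hroot _ _ _ h1 h2
    have hTpos : 0 < T q := div_pos (sub_pos.2 hqa) (hη hqpos)
    obtain ⟨t', hlo, hhi⟩ := Order.exists_between_finsets (insert 0 ((F.erase q).image T)) {T q} (by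
      intro x hx y hy
      rw [Finset.mem_singleton] at hy
      rw [Finset.mem_insert, Finset.mem_image] at hx
      rcases hx with rfl | ⟨q', hq', rfl⟩
      · rwa [hy]
      · rw [hy]
        exact hlt q' (Finset.mem_of_mem_erase hq') (Finset.ne_of_mem_erase hq'))
    have ht'q : t' < T q := hhi _ (Finset.mem_singleton_self _)
    have ht'0 : 0 < t' := hlo 0 (Finset.mem_insert_self _ _)
    have ht' : ∀ q' ∈ F, q' ≠ q → T q' < t' := fun q' h1 h2 =>
      hlo _ (Finset.mem_insert_of_mem (Finset.mem_image_of_mem _ (Finset.mem_erase.2 ⟨h2, h1⟩)))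
    have hqt' : T q < t := (hTlt hqpos t).1 hqt
    have hF' : ∀ q', q' ∈ F.erase q ↔ q'.1 ∈ S.Rpos ∧ S.coroot q'.1 a < q'.2 ∧
        q'.2 < S.coroot q'.1 (a + t' • S.eta) := by
      intro q'
      rw [Finset.mem_erase, hF q']
      constructor
      · rintro ⟨h1, h2⟩
        exact ⟨h2.1, h2.2.1, (hTlt h2.1 t').2 (ht' q' ((hF q').2 h2) h1)⟩
      · rintro ⟨h1, h2, h3⟩
        have h4 := (hTlt h1 t').1 h3
        refine ⟨?_, h1, h2, (hTlt h1 t).2 (by linarith)⟩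
        rintro rfl
        linarith
    have hgen'pos : ∀ β ∈ S.Rpos, ∀ m : ℤ, S.coroot β (a + t' • S.eta) ≠ m := by
      intro β hβ m h
      have h1 := (hTeq (q := (β, m)) hβ t').1 h
      have h2 : S.coroot β a < m := by
        rw [← h, map_add, map_smul, smul_eq_mul]
        linarith [mul_pos ht'0 (hη hβ)]
      have h3 : (β, m) ∈ F := (hF _).2 ⟨hβ, h2, (hTlt (q := (β, m)) hβ t).2 (by linarith)⟩
      by_cases h4 : (β, m) = q
      · rw [h4] at h1; linarith
      · linarith [ht' _ h3 h4]
    have hgen' : ∀ β ∈ S.R, ∀ m : ℤ, S.coroot β (a + t' • S.eta) ≠ m := by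
      intro β hβ m h
      rcases S.pos_or_neg β hβ with hp | hp
      · exact hgen'pos β hp m h
      · refine hgen'pos _ hp (-m) ?_
        rw [S.coroot_neg β hβ, LinearMap.neg_apply, h]
        push_cast
        rfl
    have hnot : S.coroot q.1 (a + t' • S.eta) < q.2 := by
      refine lt_of_le_of_ne (not_lt.1 fun h => ?_) (hgen'pos _ hqpos _)
      linarith [(hTlt hqpos t').1 h]
    have hq1 : (1 : ℝ) ≤ q.2 := by
      have h0 := (ha _ hqpos).1.trans hqa
      have h1 : 0 < q.2 := by exact_mod_cast h0
      exact_mod_cast h1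
    refine ih (F.erase q) (by rw [Finset.card_erase_of_mem hqF]; omega) t' ht'0.le hF' hgen' ?_
    refine S.base_change_adjacent ha (S.pos_subset hqpos) (n := q.2)
      (mul_neg_of_pos_of_neg (sub_pos.2 hqt) (sub_neg.2 hnot)) ?_ hgen hgen'
      (mul_pos_of_neg_of_neg (sub_neg.2 hnot) (by linarith [hu _ hqpos]))
      (mul_pos_of_neg_of_neg (sub_neg.2 hnot) (by linarith [hv _ hqpos])) hle
    intro r hr
    obtain ⟨r', hr', hr'pos, h1, h2⟩ := S.sep_ray (by linarith) hr
    have h3 : t' < T r' := by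
      refine lt_of_le_of_ne (not_lt.1 fun h => ?_) fun h => ?_
      · linarith [(hTlt hr'pos t').2 h]
      · linarith [(hTeq hr'pos t').2 h]
    have h4 : S.coroot r'.1 a < r'.2 := by
      rw [map_add, map_smul, smul_eq_mul] at h1
      linarith [mul_pos ht'0 (hη hr'pos)]
    have h5 : r' = q := by
      by_contra hne
      linarith [ht' r' ((hF r').2 ⟨hr'pos, h4, h2⟩) hne]
    rcases hr' with h | h
    · exact Or.inl (h ▸ h5)
    · right
      rw [← neg_eq_iff_eq_neg, ← h, h5]

/-- A point of the base alcove such that the ray in direction `η` never meets two hyperplanes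
at the same time. -/
lemma exists_generic : ∃ a ∈ S.A0, ∀ γ ∈ S.Rpos, ∀ γ' ∈ S.Rpos, γ ≠ γ' → ∀ n n' : ℤ, ∀ t : ℝ,
    S.coroot γ (a + t • S.eta) = n → S.coroot γ' (a + t • S.eta) ≠ n' := by
  set I := {i : S.Rpos × S.Rpos // i.1 ≠ i.2}
  set L : I → Module.Dual ℝ V := fun i =>
    S.coroot i.1.2 S.eta • S.coroot i.1.1 - S.coroot i.1.1 S.eta • S.coroot i.1.2 with hL
  have hη : ∀ γ ∈ S.Rpos, 0 < S.coroot γ S.eta := fun γ h =>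
    lt_of_lt_of_le one_pos (S.one_le_coroot_eta h)
  obtain ⟨v, hv⟩ := Module.Dual.exists_forall_ne_zero_of_forall_exists L (by
    intro i
    by_contra hcon
    push Not at hcon
    apply i.2
    have h0 : L i = 0 := LinearMap.ext hcon
    have h1 := hη _ i.1.1.2
    have h2 := hη _ i.1.2.2
    refine Subtype.ext (S.eq_of_coroot_proportional (S.pos_subset i.1.1.2)
      (S.pos_subset i.1.2.2) (div_pos h2 h1) ?_)
    have h3 := sub_eq_zero.1 h0
    rw [div_eq_inv_mul, mul_smul, h3, smul_smul, inv_mul_cancel₀ h1.ne', one_smul])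
  obtain ⟨M, hM⟩ := (S.Rpos.image fun γ => S.coroot γ S.eta).exists_le
  set c : ℝ := 1 / (|M| + 1) with hc
  have hMp : 0 < |M| + 1 := by positivity
  have hcpos : 0 < c := by positivity
  have hc1 : ∀ γ ∈ S.Rpos, 0 < S.coroot γ (c • S.eta) ∧ S.coroot γ (c • S.eta) < 1 := by
    intro γ hγ
    rw [map_smul, smul_eq_mul]
    refine ⟨mul_pos hcpos (hη γ hγ), ?_⟩
    rw [hc, one_div_mul_eq_div, div_lt_one hMp]
    have := hM _ (Finset.mem_image_of_mem _ hγ)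
    linarith [le_abs_self M]
  set U : Set ℝ := ⋂ γ ∈ S.Rpos, {ε | 0 < S.coroot γ (c • S.eta) + ε * S.coroot γ v ∧
    S.coroot γ (c • S.eta) + ε * S.coroot γ v < 1} with hU
  have hUo : IsOpen U := by
    refine isOpen_biInter_finset fun γ _ => ?_
    have hcont : Continuous fun ε : ℝ => S.coroot γ (c • S.eta) + ε * S.coroot γ v := by fun_prop
    exact (isOpen_lt continuous_const hcont).inter (isOpen_lt hcont continuous_const)
  have hU0 : (0 : ℝ) ∈ U := by
    simp only [hU, Set.mem_iInter, Set.mem_ofPred_eq, zero_mul, add_zero]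
    exact hc1
  set bad : Set ℝ := ⋃ i : I, ⋃ k : ℤ, {ε | L i (c • S.eta) + ε * L i v = k} with hbad
  have hbadc : bad.Countable := by
    refine Set.countable_iUnion fun i => Set.countable_iUnion fun k => ?_
    refine Set.Subsingleton.countable fun x hx y hy => ?_
    simp only [Set.mem_ofPred_eq] at hx hy
    exact mul_right_cancel₀ (hv i) (by linarith)
  obtain ⟨ε, hε, hεU⟩ := (hbadc.dense_compl ℝ).exists_mem_open hUo ⟨0, hU0⟩
  refine ⟨c • S.eta + ε • v, fun γ hγ => ?_, ?_⟩
  · simp only [hU, Set.mem_iInter, Set.mem_ofPred_eq] at hεU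
    have := hεU γ hγ
    rwa [map_add, map_smul _ ε v, smul_eq_mul]
  · intro γ hγ γ' hγ' hne n n' t h1 h2
    apply hε
    obtain ⟨k, hk⟩ := S.coroot_int γ (S.pos_subset hγ) _ S.eta_mem_X
    obtain ⟨k', hk'⟩ := S.coroot_int γ' (S.pos_subset hγ') _ S.eta_mem_X
    simp only [hbad, Set.mem_iUnion, Set.mem_ofPred_eq]
    refine ⟨⟨(⟨γ, hγ⟩, ⟨γ', hγ'⟩), by simpa using hne⟩, k' * n - k * n', ?_⟩
    push_cast
    rw [← h1, ← h2, ← hk, ← hk']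
    simp only [hL, map_add, map_smul, smul_eq_mul, LinearMap.sub_apply, LinearMap.smul_apply]
    ring

/-- Transported by `t_ν w₀`, a chain for `↑` becomes a Bruhat chain relative to any base point
far enough in the dominant direction. -/
lemma upLE_chain {ν : V} (hν : ν ∈ S.X) {a : V} (ha : a ∈ S.A0) {u v : V ≃ᵃ[ℝ] V}
    (hu : u ∈ S.extAff) (h : S.upLE u v) :
    v ∈ S.extAff ∧ ∃ T₀ : ℕ, ∀ T : ℕ, T₀ ≤ T →
      Relation.ReflTransGen (S.step a (a + (T : ℝ) • S.eta))
        (S.trans ν * S.ofW S.w0 * u) (S.trans ν * S.ofW S.w0 * v) := by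
  have hw0 : S.w0 ∈ S.Weyl := S.w0_mem
  induction h with
  | refl => exact ⟨hu, 0, fun T _ => .refl⟩
  | @tail y z _ hyz ih =>
    obtain ⟨hy, T₀, hT₀⟩ := ih
    obtain ⟨γ, hγ, n, hz, hlt⟩ := hyz
    have hγR := S.pos_subset hγ
    obtain ⟨r, -, hrx, hrmem⟩ := S.exists_affRefl hγR n
    have hzr : z = r * y := by
      ext x
      rw [hz, mul_apply', hrx, refl]
    obtain ⟨hβ, hβx⟩ := S.weyl_root hw0 γ hγR
    obtain ⟨k, hk⟩ := S.coroot_int _ hβ ν hν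
    obtain ⟨N, hN⟩ := exists_nat_gt (S.coroot (S.w0 γ) a - (n + k))
    refine ⟨hzr ▸ hrmem y hy, max T₀ N, fun T hT => (hT₀ T (le_of_max_le_left hT)).tail ?_⟩
    refine ⟨?_, S.w0 γ, hβ, n + k, fun x => ?_, ?_⟩
    · rw [mul_assoc]
      exact S.trans_mul_mem hν (S.ofW_mul_mem hw0 hy)
    · simp only [mul_apply', trans_apply, ofW_apply, refl, hz, map_add, hβx, hk, map_sub, map_smul]
      push_cast
      module
    · refine mul_pos_of_neg_of_neg ?_ ?_
      · have hη := S.one_le_coroot_eta (S.w0_neg γ hγ)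
        rw [S.coroot_neg _ hβ, LinearMap.neg_apply] at hη
        have hNT : (N : ℝ) ≤ T := by exact_mod_cast le_of_max_le_right hT
        have hT0 : (0 : ℝ) ≤ T := Nat.cast_nonneg T
        rw [map_add, map_smul, smul_eq_mul]
        push_cast
        nlinarith
      · simp only [mul_apply', trans_apply, ofW_apply, map_add, hβx, hk]
        push_cast
        linarith [hlt a ha]

lemma upLE_base_change {ν : V} (hν : ν ∈ S.X) {u v : V ≃ᵃ[ℝ] V} (hu : u ∈ S.extAff)
    (h : S.upLE u v)
    (hu1 : ∀ x ∈ S.A0, ∀ γ ∈ S.Rpos, S.coroot γ ((S.trans ν * S.ofW S.w0 * u) x) < 1)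
    (hv1 : ∀ x ∈ S.A0, ∀ γ ∈ S.Rpos, S.coroot γ ((S.trans ν * S.ofW S.w0 * v) x) < 1) :
    S.bruhatLE (S.trans ν * S.ofW S.w0 * u) (S.trans ν * S.ofW S.w0 * v) := by
  obtain ⟨a, ha, hcol⟩ := S.exists_generic
  obtain ⟨-, T, hT⟩ := S.upLE_chain hν ha hu h
  have hfin : {q : V × ℤ | q.1 ∈ S.Rpos ∧ S.coroot q.1 a < q.2 ∧
      q.2 < S.coroot q.1 (a + (T : ℝ) • S.eta)}.Finite :=
    (S.sep_finite a (a + (T : ℝ) • S.eta)).subset fun q hq =>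
      ⟨S.pos_subset hq.1, mul_neg_of_neg_of_pos (sub_neg.2 hq.2.1) (sub_pos.2 hq.2.2)⟩
  refine Relation.ReflTransGen.trans_induction_on (motive := fun {u v} _ => S.bruhatLE u v)
    (S.base_change_ray ha hcol (hu1 a ha) (hv1 a ha) hfin.toFinset T (Nat.cast_nonneg T)
      (fun q => hfin.mem_toFinset) ?_ (hT T le_rfl))
    (fun _ => .refl) (S.step_bruhatLE ha) (fun _ _ => Relation.ReflTransGen.trans)
  intro β hβ m hm
  obtain ⟨k, hk⟩ := S.coroot_int β hβ _ S.eta_mem_X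
  refine S.coroot_ne_int S.one_mem_extAff ha hβ (m - T * k) ?_
  rw [map_add, map_smul, hk, smul_eq_mul] at hm
  push_cast
  change S.coroot β a = _
  linarith

lemma ofW_w0_mul_wh_inv_apply (g : V ≃ᵃ[ℝ] V) (x : V) :
    S.w0 ((S.wh⁻¹ * g) x) = S.w0 S.eta + g x := by
  have h : S.wh ((S.wh⁻¹ * g) x) = g x := by rw [← mul_apply', mul_inv_cancel_left]
  rw [← h]
  generalize (S.wh⁻¹ * g) x = y
  rw [wh, mul_apply', ofW_apply, trans_apply, map_add, map_neg]
  abel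

/-- The translation part relating `s_α w₂` to its restricted representative pairs to `1` with
`α` and to at most `1` with every positive root. -/
lemma restricted_shift {α : V} (hα : α ∈ S.Δ) {ωα : V}
    (hωαf : ∀ β ∈ S.Δ, S.coroot β ωα = if β = α then 1 else 0)
    (hωαh : ∀ β ∈ S.R, S.coroot β ωα ≤ 1) {ν : V} (hν : ν ∈ S.X) {z : V}
    (hz : ∀ β ∈ S.Δ, 0 < S.coroot β z ∧ S.coroot β z < 1)
    (hd : ∀ β ∈ S.Δ, 0 < S.coroot β (ν + (z - S.coroot α z • α)) ∧
      S.coroot β (ν + (z - S.coroot α z • α)) < 1) :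
    S.coroot α ν = 1 ∧ ∀ γ ∈ S.Rpos, S.coroot γ ν ≤ 1 := by
  simp only [map_add, map_sub, map_smul, smul_eq_mul] at hd
  have hν1 : S.coroot α ν = 1 := by
    obtain ⟨k, hk⟩ := S.coroot_int α (S.simple_mem hα) ν hν
    obtain ⟨h1, h2⟩ := hd α hα
    obtain ⟨h3, h4⟩ := hz α hα
    rw [S.coroot_self α (S.simple_mem hα), hk] at h1 h2
    have h5 : ((0 : ℤ) : ℝ) < k := by push_cast; linarith
    have h6 : (k : ℝ) < (2 : ℤ) := by push_cast; linarith
    rw [Int.cast_lt] at h5 h6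
    rw [hk, show k = 1 by omega, Int.cast_one]
  refine ⟨hν1, fun γ hγ => ?_⟩
  have h : 0 ≤ S.coroot γ (ωα - ν) := by
    refine S.pos_coroot_nonneg hγ fun β hβ => ?_
    rw [map_sub, hωαf β hβ]
    split_ifs with hβα
    · rw [hβα, hν1, sub_self]
    · obtain ⟨k, hk⟩ := S.coroot_int β (S.simple_mem hβ) ν hν
      have h1 := (hd β hβ).2
      have h2 := mul_nonneg (hz α hα).1.le (neg_nonneg.2 (S.coroot_simple_nonpos hα hβ hβα))
      have h3 : (k : ℝ) < (1 : ℤ) := by push_cast; linarith [(hz β hβ).1]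
      rw [Int.cast_lt] at h3
      have h4 : (k : ℝ) ≤ (0 : ℤ) := by exact_mod_cast show k ≤ 0 by omega
      rw [hk]
      push_cast at h4
      linarith
  rw [map_sub] at h
  linarith [hωαh γ (S.pos_subset hγ)]

lemma coroot_w0_eta_add_neg {z : V} (hz : ∀ β ∈ S.Δ, S.coroot β z < 1) {γ : V}
    (hγ : γ ∈ S.Rpos) : S.coroot γ (S.w0 S.eta + z) < 0 := by
  have h := S.pos_coroot_pos hγ (x := -(S.w0 S.eta + z)) fun β hβ => by
    obtain ⟨β', hβ', -, h⟩ := S.coroot_w0 (S.simple_subset hβ)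
    rw [map_neg, map_add, h]
    linarith [S.one_le_coroot_eta hβ', hz β hβ]
  rw [map_neg] at h
  linarith

end Ctx


/-- Lemma `subregular shape bound`:
`(s_α w̃₂)^⋄ w̃₂⁻¹ s_α w₀ w̃₁ ≤ w₀ w̃_h⁻¹ (s_α w̃₂)^⋄` in the Bruhat order. -/
theorem statement5 {V : Type} [AddCommGroup V] [Module ℝ V] [FiniteDimensional ℝ V]
    (S : Ctx V) (p : ℕ) (hp : p.Prime) (hηp : ∀ α ∈ S.R, S.coroot α S.eta < (p : ℝ))
    (α : V) (hα : α ∈ S.Δ)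
    (ωα : V) (hωαX : ωα ∈ S.X)
    (hωαf : ∀ β ∈ S.Δ, S.coroot β ωα = if β = α then 1 else 0)
    (hωαh : ∀ β ∈ S.R, S.coroot β ωα ≤ 1)
    (sα : V ≃ₗ[ℝ] V) (hsα : ∀ x, sα x = x - S.coroot α x • α)
    (w₂ : V ≃ᵃ[ℝ] V) (hw₂ : w₂ ∈ S.Wone)
    (w₁ : V ≃ᵃ[ℝ] V) (hw₁ : w₁ ∈ S.Wplus)
    (hup : S.upLE w₁ (S.wh⁻¹ * w₂))
    (d : V ≃ᵃ[ℝ] V) (hd : ∃ ν ∈ S.X, d = S.trans ν * (S.ofW sα * w₂))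
    (hd₁ : d ∈ S.Wone) :
    S.bruhatLE (d * (w₂⁻¹ * (S.ofW sα * S.ofW S.w0)) * w₁)
      (S.ofW S.w0 * S.wh⁻¹ * d) := by

  have hw0 : S.w0 ∈ S.Weyl := S.w0_mem
  have hαR := S.simple_mem hα
  obtain ⟨ν, hν, rfl⟩ := hd
  have hdx : ∀ x, (S.trans ν * (S.ofW sα * w₂)) x =
      ν + (w₂ x - S.coroot α (w₂ x) • α) := fun x => by
    rw [Ctx.mul_apply', Ctx.mul_apply', Ctx.trans_apply, Ctx.ofW_apply, hsα]
  obtain ⟨a, ha, -⟩ := S.exists_generic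
  obtain ⟨hν1, hνle⟩ := S.restricted_shift hα hωαf hωαh hν (hw₂.2 a ha) fun β hβ => by
    rw [← hdx]
    exact hd₁.2 a ha β hβ
  have hleft : S.trans ν * (S.ofW sα * w₂) * (w₂⁻¹ * (S.ofW sα * S.ofW S.w0)) * w₁ =
      S.trans ν * S.ofW S.w0 * w₁ := by
    have hs : S.ofW sα * S.ofW sα = 1 := by
      ext x
      rw [Ctx.mul_apply', Ctx.ofW_apply, Ctx.ofW_apply, hsα (sα x), hsα x, map_sub, map_smul,
        S.coroot_self α hαR, smul_eq_mul]
      change _ = x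
      module
    calc _ = S.trans ν * (S.ofW sα * S.ofW sα) * S.ofW S.w0 * w₁ := by group
      _ = _ := by rw [hs, mul_one]
  have hvx : ∀ x, (S.trans ν * S.ofW S.w0 * (S.wh⁻¹ * w₂)) x = ν + (S.w0 S.eta + w₂ x) :=
    fun x => by
      rw [Ctx.mul_apply', Ctx.mul_apply', Ctx.trans_apply, Ctx.ofW_apply,
        S.ofW_w0_mul_wh_inv_apply]
  rw [hleft]
  refine (S.upLE_base_change hν hw₁.1 hup ?_ ?_).trans (S.step_bruhatLE ha ?_)
  · intro x hx γ hγ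
    obtain ⟨γ', hγ', -, h⟩ := S.coroot_w0 hγ
    rw [Ctx.mul_apply', Ctx.mul_apply', Ctx.trans_apply, Ctx.ofW_apply, map_add, h]
    linarith [hνle γ hγ, S.pos_coroot_pos hγ' (hw₁.2 x hx)]
  · intro x hx γ hγ
    rw [hvx, map_add]
    linarith [hνle γ hγ, S.coroot_w0_eta_add_neg (fun β hβ => (hw₂.2 x hx β hβ).2) hγ]
  · obtain ⟨k, hk⟩ := S.coroot_int α hαR _ (S.weyl_X hw0 _ S.eta_mem_X)
    refine ⟨?_, α, hαR, 1 + k, fun x => ?_, ?_⟩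
    · have : S.trans ν * S.ofW S.w0 * (S.wh⁻¹ * w₂) = S.trans (ν + S.w0 S.eta) * w₂ := by
        ext x
        rw [hvx, Ctx.mul_apply', Ctx.trans_apply, add_assoc]
      rw [this]
      exact S.trans_mul_mem (add_mem hν (S.weyl_X hw0 _ S.eta_mem_X)) hw₂.1
    · rw [mul_assoc, Ctx.mul_apply', Ctx.ofW_apply, S.ofW_w0_mul_wh_inv_apply, hdx, hvx, Ctx.refl]
      simp only [map_add, hν1, hk]
      push_cast
      module
    · obtain ⟨γ', hγ', -, h⟩ := S.coroot_w0 (S.simple_subset hα)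
      have hη := S.one_le_coroot_eta hγ'
      rw [h] at hk
      rw [hvx, map_add, map_add, hν1, h, hk]
      push_cast
      refine mul_pos ?_ ?_
      · linarith [(ha α (S.simple_subset hα)).1]
      · linarith [(hw₂.2 a ha α hα).1]

end SerrePaper
end
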